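/- arXiv:hep-ph/9801404 — 5 statements merged into one kernel-verified Lean document; each statement's English description precedes it below -/
import Mathlib

section
/- Let ψ₁ = ψ₁⁺ + ψ₁⁻ and ψ₂ = ψ₂⁺ + ψ₂⁻ be fields in a ring A with times t₁ ≠ t₂, and suppose that the commutators [ψ₁⁺, ψ₂⁺] and [ψ₁⁻, ψ₂⁻] lie in the center of A. Then for any finite sequences of field indices X = (x₁,...,x_p) and Y = (y₁,...,y_q), N(x₁,...,x_p, 1, 2, y₁,...,y_q) = N(x₁,...,x_p, 2, 1, y₁,...,y_q) + (D(2,1) − D(1,2)) · N(x₁,...,x_p, y₁,...,y_q). (Paper's Lemma 2.) -/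
/-- The full field: sum of its `+` and `-` parts. -/
def psi {ι A : Type*} [Ring A] (psiP psiM : ι → A) (i : ι) : A := psiP i + psiM i

/-- Two-point normal ordered product `N(i,j)`. -/
def N2 {ι A : Type*} [Ring A] (psiP psiM : ι → A) (i j : ι) : A :=
  psiP i * psiP j + psiM i * psiP j + psiM j * psiP i + psiM i * psiM j

/-- Two-point time-ordered product `T(i,j)` (for distinct times). -/
noncomputable def T2 {ι A : Type*} [Ring A] (psiP psiM : ι → A) (t : ι → ℝ) (i j : ι) : A :=
  if t i > t j then psi psiP psiM i * psi psiP psiM j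
  else psi psiP psiM j * psi psiP psiM i

/-- The contraction `D(i,j) := T(i,j) - N(i,j)`. -/
noncomputable def D2 {ι A : Type*} [Ring A] (psiP psiM : ι → A) (t : ι → ℝ) (i j : ι) : A :=
  T2 psiP psiM t i j - N2 psiP psiM i j

/-- Multi-point normal ordered product of a list of field indices:
`N(i₁,…,iₖ) = Σ_{S ⊆ {1,…,k}} (∏_{j∈S, j increasing} ψ_{i_j}⁻)·(∏_{j∉S, j increasing} ψ_{i_j}⁺)`. -/
def Nord {ι A : Type*} [Ring A] (psiP psiM : ι → A) (L : List ι) : A :=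
  ∑ S : Finset (Fin L.length),
    (((List.finRange L.length).filter (fun j => decide (j ∈ S))).map
        (fun j => psiM (L.get j))).prod *
    (((List.finRange L.length).filter (fun j => decide (j ∉ S))).map
        (fun j => psiP (L.get j))).prod

/-- Multi-point time ordered product: the fields multiplied in order of decreasing time. -/
noncomputable def Tlist {ι A : Type*} [Ring A] (psiP psiM : ι → A) (t : ι → ℝ)
    (L : List ι) : A :=
  ((L.insertionSort (fun i j => t j ≤ t i)).map (psi psiP psiM)).prod

theorem Fin.sum_finset_succ {M : Type*} [AddCommMonoid M] (n : ℕ)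
    (f : Finset (Fin (n + 1)) → M) :
    ∑ S, f S = ∑ S : Finset (Fin n), f (S.map (Fin.succEmb n)) +
      ∑ S : Finset (Fin n), f (insert 0 (S.map (Fin.succEmb n))) := by
  have h0 : (0 : Fin (n + 1)) ∉ Finset.univ.map (Fin.succEmb n) := by simp
  have hpow : (Finset.univ.map (Fin.succEmb n)).powerset =
      Finset.univ.map (Finset.mapEmbedding (Fin.succEmb n)).toEmbedding := by
    ext S
    simp [Finset.subset_map_iff, eq_comm]
  rw [← Finset.powerset_univ, Fin.univ_succ, Finset.cons_eq_insert]
  rw [show (⟨Fin.succ, Fin.succ_injective n⟩ : Fin n ↪ Fin (n + 1)) = Fin.succEmb n from rfl,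
    Finset.sum_powerset_insert h0, hpow]
  simp

/-- Normal ordered product of `L` with `u` prepended to the `-` parts and `v` to the `+` parts. -/
def nordAcc {ι A : Type*} [Ring A] (psiP psiM : ι → A) : A → A → List ι → A
  | u, v, [] => u * v
  | u, v, i :: L => nordAcc psiP psiM u (v * psiP i) L + nordAcc psiP psiM (u * psiM i) v L

section nordAcc

variable {ι A : Type*} [Ring A] (psiP psiM : ι → A)

theorem nordAcc_eq_sum (u v : A) (L : List ι) :
    nordAcc psiP psiM u v L = ∑ S : Finset (Fin L.length),
      (u * (((List.finRange L.length).filter (fun j => decide (j ∈ S))).map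
        (fun j => psiM (L.get j))).prod) *
      (v * (((List.finRange L.length).filter (fun j => decide (j ∉ S))).map
        (fun j => psiP (L.get j))).prod) := by
  induction L generalizing u v with
  | nil => simp [nordAcc]
  | cons i L ih =>
    rw [nordAcc, ih, ih]
    simp only [List.length_cons]
    rw [Fin.sum_finset_succ]
    congr 1 <;> refine Finset.sum_congr rfl fun S _ => ?_ <;>
      simp [List.finRange_succ, List.filter_map, Function.comp_def, mul_assoc]

theorem Nord_eq_nordAcc (L : List ι) : Nord psiP psiM L = nordAcc psiP psiM 1 1 L := by
  simp [nordAcc_eq_sum, Nord]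

theorem nordAcc_sub_left (u u' v : A) (L : List ι) :
    nordAcc psiP psiM (u - u') v L = nordAcc psiP psiM u v L - nordAcc psiP psiM u' v L := by
  simp only [nordAcc_eq_sum, ← Finset.sum_sub_distrib, sub_mul]

theorem nordAcc_sub_right (u v v' : A) (L : List ι) :
    nordAcc psiP psiM u (v - v') L = nordAcc psiP psiM u v L - nordAcc psiP psiM u v' L := by
  simp only [nordAcc_eq_sum, ← Finset.sum_sub_distrib, sub_mul, mul_sub]

theorem nordAcc_mul_left_of_mem_center {c : A} (hc : c ∈ Set.center A) (u v : A) (L : List ι) :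
    nordAcc psiP psiM (u * c) v L = c * nordAcc psiP psiM u v L := by
  simp only [nordAcc_eq_sum, Finset.mul_sum, ← (hc.comm u).eq, mul_assoc]

theorem nordAcc_mul_right_of_mem_center {c : A} (hc : c ∈ Set.center A) (u v : A) (L : List ι) :
    nordAcc psiP psiM u (v * c) L = c * nordAcc psiP psiM u v L := by
  simp only [nordAcc_eq_sum, Finset.mul_sum, ← (hc.comm v).eq]
  refine Finset.sum_congr rfl fun S _ => ?_
  rw [mul_assoc c v, ← mul_assoc _ c, ← (hc.comm _).eq, mul_assoc c]

theorem nordAcc_swap {i j : ι}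
    (hP : psiP i * psiP j - psiP j * psiP i ∈ Set.center A)
    (hM : psiM i * psiM j - psiM j * psiM i ∈ Set.center A) (u v : A) (X Y : List ι) :
    nordAcc psiP psiM u v (X ++ i :: j :: Y) = nordAcc psiP psiM u v (X ++ j :: i :: Y) +
      ((psiP i * psiP j - psiP j * psiP i) + (psiM i * psiM j - psiM j * psiM i)) *
        nordAcc psiP psiM u v (X ++ Y) := by
  induction X generalizing u v with
  | nil =>
    simp only [List.nil_append, nordAcc]
    rw [add_mul, ← nordAcc_mul_left_of_mem_center psiP psiM hM,
      ← nordAcc_mul_right_of_mem_center psiP psiM hP, mul_sub, mul_sub,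
      nordAcc_sub_left, nordAcc_sub_right]
    simp only [mul_assoc]
    abel
  | cons k X ih =>
    simp only [List.cons_append, nordAcc]
    rw [ih, ih, mul_add]
    abel

end nordAcc

theorem T2_comm {ι A : Type*} [Ring A] (psiP psiM : ι → A) (t : ι → ℝ) {i j : ι}
    (h : t i ≠ t j) : T2 psiP psiM t i j = T2 psiP psiM t j i := by
  rcases h.lt_or_gt with h | h <;> simp [T2, h, h.not_gt]

theorem D2_sub_D2_swap {ι A : Type*} [Ring A] (psiP psiM : ι → A) (t : ι → ℝ) {i j : ι}
    (h : t i ≠ t j) :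
    D2 psiP psiM t j i - D2 psiP psiM t i j =
      (psiP i * psiP j - psiP j * psiP i) + (psiM i * psiM j - psiM j * psiM i) := by
  rw [D2, D2, T2_comm psiP psiM t h, N2, N2]
  abel

/-- **Paper's Lemma 2.**  If the commutators `[ψ₁⁺, ψ₂⁺]` and `[ψ₁⁻, ψ₂⁻]` are central, then
for all sequences of field indices `X` and `Y`,
`N(X,1,2,Y) = N(X,2,1,Y) + (D(2,1) − D(1,2))·N(X,Y)`. -/
theorem stmt_6 {ι A : Type*} [Ring A] (psiP psiM : ι → A) (t : ι → ℝ)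
    (i₁ i₂ : ι) (ht : t i₁ ≠ t i₂)
    (hpp : psiP i₁ * psiP i₂ - psiP i₂ * psiP i₁ ∈ Set.center A)
    (hmm : psiM i₁ * psiM i₂ - psiM i₂ * psiM i₁ ∈ Set.center A)
    (X Y : List ι) :
    Nord psiP psiM (X ++ i₁ :: i₂ :: Y) =
      Nord psiP psiM (X ++ i₂ :: i₁ :: Y) +
        (D2 psiP psiM t i₂ i₁ - D2 psiP psiM t i₁ i₂) * Nord psiP psiM (X ++ Y) := by
  rw [D2_sub_D2_swap psiP psiM t ht]
  simp only [Nord_eq_nordAcc]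
  exact nordAcc_swap psiP psiM hpp hmm 1 1 X Y
end

section
/- Let {ψᵢ = ψᵢ⁺ + ψᵢ⁻ : i = 1,...,2n} be fields in a ring A with pairwise distinct times, and fix m ≤ n. Then ((2n)!/((2m)!·(n−m)!·2^{n−m})) • Σ_{a ∈ S_{2n}} N(a(1),...,a(2m)) · ∏_{j=m+1}^{n} D(a(2j−1), a(2j)) = Σ_{a ∈ S_{2n}} Σ_{b ∈ B_m} N(a(b(1)),...,a(b(2m))) · ∏_{j=m+1}^{n} D(a(b(2j−1)), a(b(2j))), where S_{2n} is the group of permutations of {1,...,2n} and • denotes natural-number scalar multiplication in A. (Paper's Lemma 3.) -/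
/-- The set `B_m` of permutations `b` of `{1,…,2n}` (realised as `Fin (2*n)`, positions
`0,…,2n−1`) such that: `b` is increasing on the first `2m` positions; `b(2j) < b(2j+1)`
for each pair position `j = m,…,n−1`; and the leading (even-position) entries of the
pairs are increasing. -/
def Bset (n m : ℕ) : Finset (Equiv.Perm (Fin (2 * n))) :=
  Finset.univ.filter fun b =>
    (∀ i j : Fin (2 * n), (i : ℕ) < (j : ℕ) → (j : ℕ) < 2 * m → b i < b j) ∧
    (∀ j : Fin n, m ≤ (j : ℕ) →
      b ⟨2 * (j : ℕ), by have := j.isLt; omega⟩ <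
        b ⟨2 * (j : ℕ) + 1, by have := j.isLt; omega⟩) ∧
    (∀ j k : Fin n, m ≤ (j : ℕ) → (j : ℕ) < (k : ℕ) →
      b ⟨2 * (j : ℕ), by have := j.isLt; omega⟩ <
        b ⟨2 * (k : ℕ), by have := k.isLt; omega⟩)

/-- `N(a(1),…,a(2m))`: the normal ordered product of the fields labelled by the images
under the permutation `a` of the first `2m` positions, in order. -/
def NBlock {A : Type*} [Ring A] {n : ℕ} (psiP psiM : Fin (2 * n) → A)
    (a : Equiv.Perm (Fin (2 * n))) (m : ℕ) : A :=
  Nord psiP psiM (((List.finRange (2 * n)).take (2 * m)).map fun i => a i)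

/-- `∏_{j=m+1}^{n} D(a(2j−1), a(2j))`: the ordered product of the contractions of the
successive pairs of `a`-images beyond the first `2m` positions. -/
noncomputable def Dprod {A : Type*} [Ring A] {n : ℕ} (psiP psiM : Fin (2 * n) → A)
    (t : Fin (2 * n) → ℝ) (a : Equiv.Perm (Fin (2 * n))) (m : ℕ) : A :=
  (((List.finRange n).drop m).map fun j : Fin n =>
    D2 psiP psiM t (a ⟨2 * (j : ℕ), by have := j.isLt; omega⟩)
      (a ⟨2 * (j : ℕ) + 1, by have := j.isLt; omega⟩)).prod

theorem Tuple.exists_perm_strictMono {k : ℕ} {X : Type*} [LinearOrder X] {f : Fin k → X}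
    (hf : Function.Injective f) : ∃ σ : Equiv.Perm (Fin k), StrictMono (f ∘ σ) :=
  ⟨Tuple.sort f, (Tuple.monotone_sort f).strictMono_of_injective
    (hf.comp (Tuple.sort f).injective)⟩

theorem StrictMono.eq_of_comp_perm_eq {k : ℕ} {X : Type*} [LinearOrder X] {f g : Fin k → X}
    (hf : StrictMono f) (hg : StrictMono g) {σ τ : Equiv.Perm (Fin k)}
    (h : ∀ i, f (σ i) = g (τ i)) : f = g ∧ σ = τ := by
  have hfg : f = g := by
    refine (hf.range_inj hg).1 ?_
    rw [← σ.surjective.range_comp f, ← τ.surjective.range_comp g]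
    exact congrArg Set.range (funext h)
  subst hfg
  exact ⟨rfl, Equiv.ext fun i => hf.injective (h i)⟩

/-- A labelling of `M` positions and `k` pairs of positions is sorted when it increases along the
`M` positions, inside each pair, and along the leading entries of the pairs. -/
def IsSortedLabelling {M k : ℕ} {X : Type*} [LinearOrder X]
    (b : Fin M ⊕ (Fin k × Fin 2) ≃ X) : Prop :=
  StrictMono (fun i => b (Sum.inl i)) ∧
    (∀ j, StrictMono fun x => b (Sum.inr (j, x))) ∧
    StrictMono fun j => b (Sum.inr (j, 0))

/-- Relabel the `M` positions, permute the `k` pairs, and permute the entries of each pair. -/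
def blockPerm {M k : ℕ}
    (h : Equiv.Perm (Fin M) × Equiv.Perm (Fin k) × (Fin k → Equiv.Perm (Fin 2))) :
    Equiv.Perm (Fin M ⊕ (Fin k × Fin 2)) :=
  Equiv.sumCongr h.1 (Equiv.prodShear h.2.1 h.2.2)

theorem bijective_blockPerm_trans {M k : ℕ} {X : Type*} [LinearOrder X] :
    Function.Bijective
      (fun p : {b : Fin M ⊕ (Fin k × Fin 2) ≃ X // IsSortedLabelling b} ×
          (Equiv.Perm (Fin M) × Equiv.Perm (Fin k) × (Fin k → Equiv.Perm (Fin 2))) =>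
        (blockPerm p.2).trans p.1.1) := by
  constructor
  · rintro ⟨⟨b, hb⟩, σ, τ, ε⟩ ⟨⟨b', hb'⟩, σ', τ', ε'⟩ h
    have hl : ∀ i, b (Sum.inl (σ i)) = b' (Sum.inl (σ' i)) := fun i =>
      DFunLike.congr_fun h (Sum.inl i)
    have hr : ∀ j x, b (Sum.inr (τ j, ε j x)) = b' (Sum.inr (τ' j, ε' j x)) := fun j x =>
      DFunLike.congr_fun h (Sum.inr (j, x))
    have hpair j := (hb.2.1 (τ j)).eq_of_comp_perm_eq (hb'.2.1 (τ' j)) (hr j)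
    obtain ⟨-, rfl⟩ := hb.1.eq_of_comp_perm_eq hb'.1 hl
    obtain ⟨-, rfl⟩ := hb.2.2.eq_of_comp_perm_eq hb'.2.2 fun j => congrFun (hpair j).1 0
    obtain rfl : ε = ε' := funext fun j => (hpair j).2
    have hbb : b = b' := Equiv.ext fun y => by
      simpa using DFunLike.congr_fun h ((blockPerm (σ, τ, ε)).symm y)
    subst hbb
    rfl
  · intro a
    obtain ⟨σ, hσ⟩ := Tuple.exists_perm_strictMono (f := fun i => a (Sum.inl i))
      (a.injective.comp Sum.inl_injective)
    choose ε hε using fun j => Tuple.exists_perm_strictMono (f := fun x => a (Sum.inr (j, x)))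
      (fun x y hxy => by simpa using hxy)
    obtain ⟨τ, hτ⟩ := Tuple.exists_perm_strictMono (f := fun j => a (Sum.inr (j, ε j 0)))
      (fun x y hxy => by simp at hxy; exact hxy.1)
    let h := (σ.symm, τ.symm, fun j => (ε j).symm)
    refine ⟨(⟨(blockPerm h).symm.trans a, ?_, fun j => ?_, ?_⟩, h), ?_⟩
    · exact hσ
    · exact hε (τ j)
    · exact hτ
    · ext y
      simp

theorem card_isSortedLabelling_mul {M k : ℕ} {X : Type*} [LinearOrder X]
    (e : Fin M ⊕ (Fin k × Fin 2) ≃ X) :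
    Nat.card {b : Fin M ⊕ (Fin k × Fin 2) ≃ X // IsSortedLabelling b} *
      (M.factorial * k.factorial * 2 ^ k) = (M + k * 2).factorial := by
  have h := Nat.card_congr (Equiv.ofBijective _ (bijective_blockPerm_trans (M := M) (k := k)
    (X := X)))
  have he := Nat.card_congr (Equiv.equivCongr (Equiv.refl (Fin M ⊕ (Fin k × Fin 2))) e)
  rw [← he] at h
  simpa [Nat.card_prod, Nat.card_pi, Fintype.card_perm, Fintype.card_equiv (Equiv.refl _),
    mul_assoc] using h

/-- Split the `2 * n` positions into the first `2 * m` and the `n - m` pairs that follow. -/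
noncomputable def positionEquiv {n m : ℕ} (hm : m ≤ n) :
    Fin (2 * m) ⊕ (Fin (n - m) × Fin 2) ≃ Fin (2 * n) :=
  Equiv.ofBijective
    (Sum.elim (fun i => ⟨i, by omega⟩) (fun p => ⟨2 * (m + p.1) + p.2, by omega⟩)) <| by
    rw [Fintype.bijective_iff_injective_and_card]
    refine ⟨?_, by simp; omega⟩
    rintro (⟨i, hi⟩ | ⟨⟨j, hj⟩, ⟨x, hx⟩⟩) (⟨i', hi'⟩ | ⟨⟨j', hj'⟩, ⟨x', hx'⟩⟩) h <;>
      simp at h ⊢ <;> omega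

theorem mem_Bset_iff {n m : ℕ} (hm : m ≤ n) (b : Equiv.Perm (Fin (2 * n))) :
    b ∈ Bset n m ↔ IsSortedLabelling ((positionEquiv hm).trans b) := by
  simp only [Bset, Finset.mem_filter, Finset.mem_univ, true_and, IsSortedLabelling]
  refine and_congr ?_ (and_congr ?_ ?_)
  · constructor
    · intro h i j hij
      exact h _ _ hij j.isLt
    · intro h i j hij hj
      exact h (a := ⟨i, hij.trans hj⟩) (b := ⟨j, hj⟩) hij
  · constructor
    · intro h j
      rw [Fin.strictMono_iff_lt_succ]
      intro x
      obtain rfl := Subsingleton.elim x 0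
      exact h ⟨m + j, by omega⟩ (Nat.le_add_right _ _)
    · intro h j hj
      obtain ⟨c, hc⟩ := Nat.exists_eq_add_of_le hj
      obtain ⟨j, hjn⟩ := j
      obtain rfl : j = m + c := hc
      exact h ⟨c, by omega⟩ (a := 0) (b := 1) (by decide)
  · constructor
    · intro h j k hjk
      exact h ⟨m + j, by omega⟩ ⟨m + k, by omega⟩ (Nat.le_add_right _ _)
        (Nat.add_lt_add_left hjk m)
    · rintro h ⟨j, hjn⟩ ⟨k, hkn⟩ hj hjk
      obtain ⟨c, rfl⟩ := Nat.exists_eq_add_of_le hj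
      obtain ⟨d, rfl⟩ := Nat.exists_eq_add_of_le (hj.trans hjk.le)
      exact h (a := ⟨c, by omega⟩) (b := ⟨d, by omega⟩) (Nat.lt_of_add_lt_add_left hjk)

theorem card_Bset {n m : ℕ} (hm : m ≤ n) :
    (Bset n m).card =
      (2 * n).factorial / ((2 * m).factorial * (n - m).factorial * 2 ^ (n - m)) := by
  have hcard : (Bset n m).card = Nat.card {b : Fin (2 * m) ⊕ (Fin (n - m) × Fin 2) ≃ Fin (2 * n) //
      IsSortedLabelling b} := by
    rw [← Nat.card_eq_finsetCard]
    refine Nat.card_congr (Equiv.subtypeEquiv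
      (Equiv.equivCongr (positionEquiv hm).symm (Equiv.refl (Fin (2 * n)))) fun b => ?_)
    exact mem_Bset_iff hm b
  have h := card_isSortedLabelling_mul (positionEquiv hm)
  rw [← hcard, show 2 * m + (n - m) * 2 = 2 * n by omega] at h
  exact (Nat.div_eq_of_eq_mul_left (by positivity) h.symm).symm

/-- **Paper's Lemma 3.**  For `m ≤ n` and fields with pairwise distinct times,
`((2n)!/((2m)!·(n−m)!·2^{n−m})) • Σ_a N(a(1),…,a(2m))·∏_j D(a(2j−1),a(2j))
  = Σ_a Σ_{b ∈ B_m} N(a(b(1)),…,a(b(2m)))·∏_j D(a(b(2j−1)),a(b(2j)))`. -/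
theorem stmt_9 {A : Type*} [Ring A] (n m : ℕ) (hm : m ≤ n)
    (psiP psiM : Fin (2 * n) → A) (t : Fin (2 * n) → ℝ) (ht : Function.Injective t) :
    ((2 * n).factorial / ((2 * m).factorial * (n - m).factorial * 2 ^ (n - m))) •
        ∑ a : Equiv.Perm (Fin (2 * n)),
          NBlock psiP psiM a m * Dprod psiP psiM t a m =
      ∑ a : Equiv.Perm (Fin (2 * n)), ∑ b ∈ Bset n m,
        NBlock psiP psiM (b.trans a) m * Dprod psiP psiM t (b.trans a) m := by
  rw [Finset.sum_comm, ← card_Bset hm, ← Finset.sum_const]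
  refine Finset.sum_congr rfl fun b _ => ?_
  exact (Fintype.sum_equiv (Equiv.mulRight b) _ _ fun a => rfl).symm
end

section
/- Let {ψᵢ = ψᵢ⁺ + ψᵢ⁻ : i = 1,...,2n} be fields in a ring A with pairwise distinct times, and suppose every commutator [ψᵢ^ε, ψⱼ^δ] with ε, δ ∈ {+,−} lies in the center of A (the contraction is a c-number). For a permutation a of {1,...,2n} define S(a) := Σ_{m=0}^{n} Σ_{b ∈ B_m} N(a(b(1)),...,a(b(2m))) · ∏_{j=m+1}^{n} D(a(b(2j−1)), a(b(2j))). Then S(a) = S(a') for any two permutations a and a' of {1,...,2n}. (Paper's Lemma 4.) -/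
open Equiv

/-- An increasing pair keeps its order under an adjacent transposition that does not exchange it. -/
lemma swap_adjacent_lt {N : ℕ} {k k' i j : Fin N} (hk : (k : ℕ) + 1 = k') (hij : i < j)
    (h : ¬ (i = k ∧ j = k')) : swap k k' i < swap k k' j := by
  simp only [swap_apply_def]
  simp only [Fin.lt_def, Fin.ext_iff] at *
  split_ifs <;> omega

/-- The fixed points of a permutation in increasing order. -/
def fixList {N : ℕ} (s : Perm (Fin N)) : List (Fin N) :=
  (List.finRange N).filter fun i => s i = i

lemma mem_fixList {N : ℕ} {s : Perm (Fin N)} {i : Fin N} : i ∈ fixList s ↔ s i = i := by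
  simp [fixList]

lemma pairwise_fixList {N : ℕ} (s : Perm (Fin N)) : (fixList s).Pairwise (· < ·) :=
  (List.sortedLT_finRange N).pairwise.filter _

/-- The term attached to the partial matching encoded by the involution `s`: the contractions
`D` of the matched pairs times the value of `F` at the unmatched entries. -/
def matchingTerm {R M ι : Type*} [CommRing R] [AddCommGroup M] [Module R M] {N : ℕ}
    (F : List ι → M) (D : ι → ι → R) (a : Fin N → ι) (s : Perm (Fin N)) : M :=
  (∏ i with i < s i, D (a i) (a (s i))) • F ((fixList s).map a)

section Swap

variable {R M ι : Type*} [CommRing R] [AddCommGroup M] [Module R M] {N : ℕ}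
  (F : List ι → M) (D : ι → ι → R)

lemma fixList_conj_swap {k k' : Fin N} (hk : (k : ℕ) + 1 = k') {s : Perm (Fin N)}
    (h : ¬ (s k = k ∧ s k' = k')) :
    fixList (swap k k' * s * swap k k') = (fixList s).map (swap k k') := by
  refine List.Pairwise.eq_of_mem_iff (r := (· < ·)) (pairwise_fixList _) ?_ ?_
  · rw [List.pairwise_map]
    refine (pairwise_fixList s).imp_of_mem fun {i j} hi hj hij => ?_
    refine swap_adjacent_lt hk hij ?_
    rintro ⟨rfl, rfl⟩
    exact h ⟨mem_fixList.1 hi, mem_fixList.1 hj⟩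
  · intro x
    simp only [mem_fixList, List.mem_map, Perm.mul_apply]
    constructor
    · intro hx
      refine ⟨swap k k' x, ?_, swap_apply_self _ _ _⟩
      conv_rhs => rw [← hx]
      simp
    · rintro ⟨y, hy, rfl⟩
      simp [hy]

lemma matchingTerm_conj_swap {k k' : Fin N} (hk : (k : ℕ) + 1 = k') {s : Perm (Fin N)}
    (hs : s * s = 1) (h : ¬ (s k = k ∧ s k' = k')) (h' : s k ≠ k') (a : Fin N → ι) :
    matchingTerm F D a (swap k k' * s * swap k k') = matchingTerm F D (a ∘ swap k k') s := by
  have hss (i : Fin N) : s (s i) = i := by rw [← Perm.mul_apply, hs, Perm.one_apply]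
  have key (i : Fin N) (hi : i < s i) : swap k k' i < swap k k' (s i) := by
    refine swap_adjacent_lt hk hi ?_
    rintro ⟨rfl, hj⟩
    exact h' hj
  have key' (i : Fin N) (hi : i < swap k k' (s (swap k k' i))) :
      swap k k' i < s (swap k k' i) := by
    have := swap_adjacent_lt hk hi ?_
    · simpa using this
    rintro ⟨rfl, hj⟩
    have : s k' = i := by simpa [swap_apply_eq_iff] using hj
    exact h' (by rw [← this, hss])
  rw [matchingTerm, matchingTerm, fixList_conj_swap hk h, List.map_map]
  congr 1
  refine Finset.prod_nbij' (swap k k') (swap k k') ?_ ?_ ?_ ?_ ?_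
  · intro i hi
    rw [Finset.mem_filter] at hi ⊢
    exact ⟨Finset.mem_univ _, key' i hi.2⟩
  · intro i hi
    rw [Finset.mem_filter] at hi ⊢
    exact ⟨Finset.mem_univ _, by simpa using key i hi.2⟩
  · simp
  · simp
  · simp

lemma fixList_of_fixed {k k' : Fin N} (hk : (k : ℕ) + 1 = k') {s : Perm (Fin N)}
    (h : s k = k) (h' : s k' = k') :
    fixList s = (fixList s).filter (· < k) ++ k :: k' :: (fixList s).filter (k' < ·) := by
  refine List.Pairwise.eq_of_mem_iff (r := (· < ·)) (pairwise_fixList _) ?_ ?_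
  · have := pairwise_fixList s
    refine List.pairwise_append.2 ⟨this.filter _, List.pairwise_cons.2 ⟨?_, List.pairwise_cons.2
      ⟨?_, this.filter _⟩⟩, ?_⟩ <;>
      simp only [List.mem_cons, List.mem_filter, decide_eq_true_eq, Fin.lt_def] <;> grind
  · intro x
    simp only [List.mem_append, List.mem_cons, List.mem_filter, decide_eq_true_eq, mem_fixList,
      Fin.lt_def]
    have := Fin.ext_iff (a := x) (b := k)
    have := Fin.ext_iff (a := x) (b := k')
    grind

lemma fixList_swap_mul {k k' : Fin N} (hk : (k : ℕ) + 1 = k') {s : Perm (Fin N)}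
    (h : s k = k) (h' : s k' = k') :
    fixList (swap k k' * s) = (fixList s).filter (· < k) ++ (fixList s).filter (k' < ·) := by
  have hne : k ≠ k' := by rintro rfl; omega
  refine List.Pairwise.eq_of_mem_iff (r := (· < ·)) (pairwise_fixList _) ?_ ?_
  · have := pairwise_fixList s
    refine List.pairwise_append.2 ⟨this.filter _, this.filter _, ?_⟩
    simp only [List.mem_filter, decide_eq_true_eq, Fin.lt_def]
    grind
  · intro x
    simp only [List.mem_append, List.mem_filter, decide_eq_true_eq, mem_fixList,
      Fin.lt_def, Perm.mul_apply]
    have e := Fin.ext_iff (a := x) (b := k)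
    have e' := Fin.ext_iff (a := x) (b := k')
    by_cases hx : x = k
    · subst hx; simp [h, hne.symm]; omega
    by_cases hx' : x = k'
    · subst hx'; simp [h', hne]; omega
    have : s x ≠ k := fun hh => hx (s.injective (hh.trans h.symm))
    have : s x ≠ k' := fun hh => hx' (s.injective (hh.trans h'.symm))
    rw [swap_apply_of_ne_of_ne (by assumption) (by assumption)]
    have : (x : ℕ) < k ∨ (k' : ℕ) < x := by grind
    tauto

lemma prod_swap_mul {k k' : Fin N} (hk : (k : ℕ) + 1 = k') {s : Perm (Fin N)}
    (h : s k = k) (h' : s k' = k') (a : Fin N → ι) :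
    ∏ i with i < (swap k k' * s) i, D (a i) (a ((swap k k' * s) i)) =
      D (a k) (a k') * ∏ i with i < s i, D (a i) (a (s i)) := by
  have hne : k ≠ k' := by rintro rfl; omega
  have hlt : k < k' := by rw [Fin.lt_def]; omega
  have hsw (x : Fin N) (hx : x ≠ k) (hx' : x ≠ k') : swap k k' (s x) = s x :=
    swap_apply_of_ne_of_ne (fun hh => hx (s.injective (hh.trans h.symm)))
      (fun hh => hx' (s.injective (hh.trans h'.symm)))
  have hset : (Finset.univ.filter fun i => i < (swap k k' * s) i) =
      insert k (Finset.univ.filter fun i => i < s i) := by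
    ext x
    rw [Finset.mem_insert, Finset.mem_filter, Finset.mem_filter, Perm.mul_apply]
    by_cases hx : x = k
    · subst hx; simp [h, hlt]
    by_cases hx' : x = k'
    · subst hx'; simp [h', hx, hlt.le]
    simp [hx, hsw x hx hx']
  rw [hset, Finset.prod_insert (by simp [h])]
  congr 1
  · simp [h]
  · refine Finset.prod_congr rfl fun x hx => ?_
    simp only [Finset.mem_filter, Finset.mem_univ, true_and] at hx
    rw [Perm.mul_apply, hsw x (by rintro rfl; simp [h] at hx) (by rintro rfl; simp [h'] at hx)]

lemma matchingTerm_add_swap_mul (c : ι → ι → R)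
    (hF : ∀ L₁ L₂ x y, F (L₁ ++ x :: y :: L₂) = F (L₁ ++ y :: x :: L₂) + c x y • F (L₁ ++ L₂))
    (hD : ∀ x y, x ≠ y → D y x = D x y + c x y)
    {k k' : Fin N} (hk : (k : ℕ) + 1 = k') {s : Perm (Fin N)}
    (h : s k = k) (h' : s k' = k') (a : Fin N → ι) (ha : Function.Injective a) :
    matchingTerm F D (a ∘ swap k k') s + matchingTerm F D (a ∘ swap k k') (swap k k' * s) =
      matchingTerm F D a s + matchingTerm F D a (swap k k' * s) := by
  have hne : k ≠ k' := by rintro rfl; omega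
  have hlo : ((fixList s).filter (· < k)).map (a ∘ swap k k') =
      ((fixList s).filter (· < k)).map a := by
    refine List.map_congr_left fun x hx => ?_
    simp only [List.mem_filter, decide_eq_true_eq, Fin.lt_def] at hx
    rw [Function.comp_apply, swap_apply_of_ne_of_ne] <;> rintro rfl <;> omega
  have hhi : ((fixList s).filter (k' < ·)).map (a ∘ swap k k') =
      ((fixList s).filter (k' < ·)).map a := by
    refine List.map_congr_left fun x hx => ?_
    simp only [List.mem_filter, decide_eq_true_eq, Fin.lt_def] at hx
    rw [Function.comp_apply, swap_apply_of_ne_of_ne] <;> rintro rfl <;> omega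
  have hprod : ∏ i with i < s i, D ((a ∘ swap k k') i) ((a ∘ swap k k') (s i)) =
      ∏ i with i < s i, D (a i) (a (s i)) := by
    refine Finset.prod_congr rfl fun x hx => ?_
    simp only [Finset.mem_filter, Finset.mem_univ, true_and] at hx
    have hx1 : x ≠ k := by rintro rfl; simp [h] at hx
    have hx2 : x ≠ k' := by rintro rfl; simp [h'] at hx
    rw [Function.comp_apply, Function.comp_apply, swap_apply_of_ne_of_ne hx1 hx2,
      swap_apply_of_ne_of_ne (fun hh => hx1 (s.injective (hh.trans h.symm)))
      (fun hh => hx2 (s.injective (hh.trans h'.symm)))]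
  have e₁ := fixList_of_fixed hk h h'
  have e₂ := fixList_swap_mul hk h h'
  generalize (fixList s).filter (· < k) = L₁ at e₁ e₂ hlo
  generalize (fixList s).filter (k' < ·) = L₂ at e₁ e₂ hhi
  simp only [matchingTerm, prod_swap_mul D hk h h', hprod, e₁, e₂]
  simp only [List.map_append, List.map_cons, hlo, hhi, Function.comp_apply, swap_apply_left,
    swap_apply_right, hF _ _ (a k) (a k'), hD (a k) (a k') (ha.ne hne)]
  module

/-- The sum over partial matchings does not change under an adjacent transposition. -/
lemma sum_matchingTerm_swap (c : ι → ι → R)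
    (hF : ∀ L₁ L₂ x y, F (L₁ ++ x :: y :: L₂) = F (L₁ ++ y :: x :: L₂) + c x y • F (L₁ ++ L₂))
    (hD : ∀ x y, x ≠ y → D y x = D x y + c x y)
    {k k' : Fin N} (hk : (k : ℕ) + 1 = k') (a : Fin N → ι) (ha : Function.Injective a) :
    ∑ s : Perm (Fin N) with s * s = 1, matchingTerm F D (a ∘ swap k k') s =
      ∑ s : Perm (Fin N) with s * s = 1, matchingTerm F D a s := by
  have hmem {s : Perm (Fin N)} (hs : s ∈ Finset.univ.filter fun s : Perm (Fin N) => s * s = 1) :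
      swap k k' * s * swap k k' ∈ Finset.univ.filter fun s : Perm (Fin N) => s * s = 1 := by
    simp only [Finset.mem_filter, Finset.mem_univ, true_and] at hs ⊢
    calc _ = swap k k' * (s * ((swap k k' * swap k k') * s)) * swap k k' := by group
      _ = 1 := by rw [swap_mul_self, one_mul, hs, mul_one, swap_mul_self]
  have hconj : ∑ s : Perm (Fin N) with s * s = 1, matchingTerm F D a s =
      ∑ s : Perm (Fin N) with s * s = 1,
        matchingTerm F D a (swap k k' * s * swap k k') := by
    refine Finset.sum_nbij' (fun s => swap k k' * s * swap k k')
      (fun s => swap k k' * s * swap k k') ?_ ?_ ?_ ?_ ?_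
    · exact fun s hs => hmem hs
    · exact fun s hs => hmem hs
    all_goals simp [mul_assoc]
  rw [hconj, ← sub_eq_zero, ← Finset.sum_sub_distrib]
  have hne : k ≠ k' := by rintro rfl; omega
  have hcomm {s : Perm (Fin N)} (h : (s k = k ∧ s k' = k') ∨ (s k = k' ∧ s k' = k)) :
      swap k k' * s = s * swap k k' := by
    rw [mul_swap_eq_swap_mul]
    rcases h with h | h <;> rw [h.1, h.2]
    rw [swap_comm]
  have hconj' {s : Perm (Fin N)} (h : (s k = k ∧ s k' = k') ∨ (s k = k' ∧ s k' = k)) :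
      swap k k' * s * swap k k' = s := by
    rw [hcomm h, mul_assoc, swap_mul_self, mul_one]
  have hcond {s : Perm (Fin N)} (h : (s k = k ∧ s k' = k') ∨ (s k = k' ∧ s k' = k)) :
      ((swap k k' * s) k = k ∧ (swap k k' * s) k' = k') ∨
        ((swap k k' * s) k = k' ∧ (swap k k' * s) k' = k) := by
    rcases h with h | h <;> simp [h.1, h.2]
  refine Finset.sum_involution (fun s _ => if (s k = k ∧ s k' = k') ∨ (s k = k' ∧ s k' = k)
    then swap k k' * s else s) ?_ ?_ ?_ ?_
  · intro s hs
    simp only [Finset.mem_filter, Finset.mem_univ, true_and] at hs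
    split_ifs with hc
    · rw [hconj' hc, hconj' (hcond hc)]
      rcases hc with hc | hc
      · have := matchingTerm_add_swap_mul F D c hF hD hk hc.1 hc.2 a ha
        rw [← sub_eq_zero] at this
        rw [← this]
        abel
      · have := matchingTerm_add_swap_mul F D c hF hD hk (s := swap k k' * s) (by simp [hc.1])
          (by simp [hc.2]) a ha
        rw [swap_mul_self_mul, ← sub_eq_zero] at this
        rw [← this]
        abel
    · have h1 : ¬ (s k = k ∧ s k' = k') := fun h => hc (Or.inl h)
      have h2 : s k ≠ k' := fun h => hc (Or.inr ⟨h, by rw [← h, ← Perm.mul_apply, hs,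
        Perm.one_apply]⟩)
      simp [matchingTerm_conj_swap F D hk hs h1 h2]
  · intro s hs hne0
    split_ifs with hc
    · intro h
      have : swap k k' = 1 := by simpa using h
      exact hne (swap_eq_one_iff.1 this)
    · refine absurd ?_ hne0
      simp only [Finset.mem_filter, Finset.mem_univ, true_and] at hs
      have h1 : ¬ (s k = k ∧ s k' = k') := fun h => hc (Or.inl h)
      have h2 : s k ≠ k' := fun h => hc (Or.inr ⟨h, by rw [← h, ← Perm.mul_apply, hs,
        Perm.one_apply]⟩)
      rw [matchingTerm_conj_swap F D hk hs h1 h2, sub_self]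
  · intro s hs
    simp only [Finset.mem_filter, Finset.mem_univ, true_and] at hs ⊢
    split_ifs with hc
    · rw [← mul_assoc, hconj' hc, hs]
    · exact hs
  · intro s hs
    by_cases hc : (s k = k ∧ s k' = k') ∨ (s k = k' ∧ s k' = k)
    · simp only [if_pos hc, if_pos (hcond hc), swap_mul_self_mul]
    · simp only [if_neg hc]

lemma sum_matchingTerm_comp_perm (c : ι → ι → R)
    (hF : ∀ L₁ L₂ x y, F (L₁ ++ x :: y :: L₂) = F (L₁ ++ y :: x :: L₂) + c x y • F (L₁ ++ L₂))
    (hD : ∀ x y, x ≠ y → D y x = D x y + c x y)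
    (p : Perm (Fin N)) (a : Fin N → ι) (ha : Function.Injective a) :
    ∑ s : Perm (Fin N) with s * s = 1, matchingTerm F D (a ∘ p) s =
      ∑ s : Perm (Fin N) with s * s = 1, matchingTerm F D a s := by
  cases N with
  | zero => rw [Subsingleton.elim p 1]; rfl
  | succ N =>
    have hp : p ∈ Submonoid.closure (Set.range fun i : Fin N => swap i.castSucc i.succ) := by
      rw [Perm.mclosure_swap_castSucc_succ]; trivial
    induction hp using Submonoid.closure_induction generalizing a with
    | mem x hx =>
      obtain ⟨i, rfl⟩ := hx
      exact sum_matchingTerm_swap F D c hF hD (by simp) a ha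
    | one => rfl
    | mul x y _ _ ihx ihy =>
      rw [Perm.coe_mul, ← Function.comp_assoc, ihy _ (ha.comp x.injective), ihx a ha]

end Swap

/-- Split the subsets of `Fin (n + 1)` according to whether they contain `0`. -/
lemma sum_finset_fin_succ {A : Type*} [AddCommMonoid A] {n : ℕ} (f : Finset (Fin (n + 1)) → A) :
    ∑ S, f S = ∑ S : Finset (Fin n), f (insert 0 (S.map (Fin.succEmb n))) +
      ∑ S : Finset (Fin n), f (S.map (Fin.succEmb n)) := by
  rw [← Finset.sum_filter_add_sum_filter_not Finset.univ (fun S => (0 : Fin (n + 1)) ∈ S)]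
  have hcases (S : Finset (Fin (n + 1))) (i : Fin (n + 1)) (h : i ≠ 0) :
      i ∈ (Finset.univ.filter fun j : Fin n => j.succ ∈ S).map (Fin.succEmb n) ↔ i ∈ S := by
    obtain ⟨j, rfl⟩ := Fin.exists_succ_eq.2 h
    simp
  congr 1
  · refine (Finset.sum_nbij' (fun S => insert 0 (S.map (Fin.succEmb n)))
      (fun S => Finset.univ.filter fun j : Fin n => j.succ ∈ S) ?_ ?_ ?_ ?_ ?_).symm
    · simp
    · simp
    · intro S _; ext; simp
    · intro S hS
      simp only [Finset.mem_filter, Finset.mem_univ, true_and] at hS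
      ext i
      by_cases h : i = 0
      · simp [h, hS]
      · simp only [Finset.mem_insert, h, false_or, hcases S i h]
    · simp
  · refine (Finset.sum_nbij' (fun S => S.map (Fin.succEmb n))
      (fun S => Finset.univ.filter fun j : Fin n => j.succ ∈ S) ?_ ?_ ?_ ?_ ?_).symm
    · simp
    · simp
    · intro S _; ext; simp
    · intro S hS
      simp only [Finset.mem_filter, Finset.mem_univ, true_and] at hS
      ext i
      by_cases h : i = 0
      · simp [h, hS]
      · exact hcases S i h
    · simp

section NormalOrder

variable {ι A : Type*} [Ring A] (psiP psiM : ι → A)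

/-- The normal ordered product of a list with `u` inserted between the `-` and the `+` parts. -/
def nordAround : List ι → A → A
  | [], u => u
  | x :: L, u => psiM x * nordAround L u + nordAround L (u * psiP x)

lemma nordAround_add (L : List ι) (u v : A) :
    nordAround psiP psiM L (u + v) = nordAround psiP psiM L u + nordAround psiP psiM L v := by
  induction L generalizing u v with
  | nil => rfl
  | cons x L ih => simp only [nordAround, add_mul, ih, mul_add]; abel

lemma nordAround_mul_center (L : List ι) (u : A) {z : A} (hz : z ∈ Set.center A) :
    nordAround psiP psiM L (u * z) = z * nordAround psiP psiM L u := by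
  induction L generalizing u with
  | nil => exact (hz.comm u).symm
  | cons x L ih =>
    rw [nordAround, nordAround, ih, mul_assoc u, (hz.comm (psiP x)).eq, ← mul_assoc u, ih, mul_add,
      ← mul_assoc, ← mul_assoc, (hz.comm (psiM x)).eq]

lemma nordAround_swap {x y : ι} (hP : psiP x * psiP y - psiP y * psiP x ∈ Set.center A)
    (hM : psiM x * psiM y - psiM y * psiM x ∈ Set.center A) (L₁ L₂ : List ι) (u : A) :
    nordAround psiP psiM (L₁ ++ x :: y :: L₂) u = nordAround psiP psiM (L₁ ++ y :: x :: L₂) u +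
      (psiP x * psiP y - psiP y * psiP x + (psiM x * psiM y - psiM y * psiM x)) *
        nordAround psiP psiM (L₁ ++ L₂) u := by
  induction L₁ generalizing u with
  | nil =>
    have h : u * psiP x * psiP y =
        u * psiP y * psiP x + u * (psiP x * psiP y - psiP y * psiP x) := by noncomm_ring
    simp only [List.nil_append, nordAround]
    rw [h, nordAround_add, nordAround_mul_center _ _ _ _ hP]
    noncomm_ring
  | cons z L ih =>
    have hc := (Set.add_mem_center hP hM).comm (psiM z)
    simp only [List.cons_append, nordAround, ih, mul_add]
    rw [← mul_assoc (psiM z) _ (nordAround _ _ _ _), ← hc.eq]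
    noncomm_ring

lemma nordAround_eq_sum (L : List ι) (u : A) :
    nordAround psiP psiM L u = ∑ S : Finset (Fin L.length),
      (((List.finRange L.length).filter (fun j => decide (j ∈ S))).map
        (fun j => psiM (L.get j))).prod * u *
      (((List.finRange L.length).filter (fun j => decide (j ∉ S))).map
        (fun j => psiP (L.get j))).prod := by
  induction L generalizing u with
  | nil => simp [nordAround]
  | cons x L ih =>
    rw [nordAround, ih, ih, Finset.mul_sum]
    refine Eq.trans ?_ (sum_finset_fin_succ _).symm
    congr 1 <;> refine Finset.sum_congr rfl fun S _ => ?_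
    · simp [List.finRange_succ, List.filter_map, Function.comp_def, mul_assoc]
    · simp [List.finRange_succ, List.filter_map, Function.comp_def, mul_assoc]

lemma Nord_eq_nordAround (L : List ι) : Nord psiP psiM L = nordAround psiP psiM L 1 := by
  simp [Nord, nordAround_eq_sum]

lemma D2_mem_center (t : ι → ℝ)
    (hpp : ∀ i j, psiP i * psiP j - psiP j * psiP i ∈ Set.center A)
    (hpm : ∀ i j, psiP i * psiM j - psiM j * psiP i ∈ Set.center A)
    (hmm : ∀ i j, psiM i * psiM j - psiM j * psiM i ∈ Set.center A) (i j : ι) :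
    D2 psiP psiM t i j ∈ Set.center A := by
  by_cases h : t i > t j
  · have : D2 psiP psiM t i j = psiP i * psiM j - psiM j * psiP i := by
      simp only [D2, T2, if_pos h, psi, N2]; noncomm_ring
    rw [this]; exact hpm i j
  · have : D2 psiP psiM t i j = (psiP j * psiP i - psiP i * psiP j) +
        (psiP j * psiM i - psiM i * psiP j) + (psiM j * psiM i - psiM i * psiM j) := by
      simp only [D2, T2, if_neg h, psi, N2]; noncomm_ring
    rw [this]
    exact Set.add_mem_center (Set.add_mem_center (hpp _ _) (hpm _ _)) (hmm _ _)

lemma D2_swap (t : ι → ℝ) (ht : Function.Injective t) {i j : ι} (hij : i ≠ j) :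
    D2 psiP psiM t j i = D2 psiP psiM t i j +
      (psiP i * psiP j - psiP j * psiP i + (psiM i * psiM j - psiM j * psiM i)) := by
  rcases lt_or_gt_of_ne (ht.ne hij) with h | h <;>
    simp only [D2, T2, gt_iff_lt, h, h.not_gt, if_true, if_false, psi, N2] <;> noncomm_ring

end NormalOrder

section Involution

/-- The left endpoints of the pairs exchanged by a permutation, in increasing order. -/
def leadList {N : ℕ} (s : Perm (Fin N)) : List (Fin N) :=
  (List.finRange N).filter fun i => i < s i

lemma mem_leadList {N : ℕ} {s : Perm (Fin N)} {i : Fin N} : i ∈ leadList s ↔ i < s i := by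
  simp [leadList]

lemma pairwise_leadList {N : ℕ} (s : Perm (Fin N)) : (leadList s).Pairwise (· < ·) :=
  (List.sortedLT_finRange N).pairwise.filter _

lemma length_fixList_add {N : ℕ} {s : Perm (Fin N)} (hs : s * s = 1) :
    (fixList s).length + 2 * (leadList s).length = N := by
  have hss (i : Fin N) : s (s i) = i := by rw [← Perm.mul_apply, hs, Perm.one_apply]
  have hF : (fixList s).toFinset = Finset.univ.filter fun i => s i = i := by
    ext; simp [mem_fixList]
  have hP : (leadList s).toFinset = Finset.univ.filter fun i => i < s i := by
    ext; simp [mem_leadList]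
  rw [← List.toFinset_card_of_nodup ((pairwise_fixList s).imp ne_of_lt),
    ← List.toFinset_card_of_nodup ((pairwise_leadList s).imp ne_of_lt), hF, hP]
  have hQ : (Finset.univ.filter fun i => i < s i).card =
      (Finset.univ.filter fun i => s i < i).card :=
    Finset.card_nbij' s s (fun i hi => by simpa [hss] using hi)
      (fun i hi => by simpa [hss] using hi) (fun i _ => hss i) (fun i _ => hss i)
  have h1 := Finset.card_filter_add_card_filter_not (s := Finset.univ)
    (fun i : Fin N => s i = i)
  have h2 : (Finset.univ.filter fun i => ¬ s i = i) =
      (Finset.univ.filter fun i => i < s i) ∪ (Finset.univ.filter fun i => s i < i) := by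
    ext i
    simp only [Finset.mem_filter, Finset.mem_univ, true_and, Finset.mem_union]
    rw [lt_or_lt_iff_ne, ne_comm]
  rw [h2, Finset.card_union_of_disjoint, Finset.card_univ, Fintype.card_fin] at h1
  · omega
  · rw [Finset.disjoint_filter]
    exact fun i _ h => h.not_gt

variable {n : ℕ}

/-- The first position of the `j`-th pair. -/
def evenPos (j : Fin n) : Fin (2 * n) := ⟨2 * (j : ℕ), by have := j.isLt; omega⟩

/-- The second position of the `j`-th pair. -/
def oddPos (j : Fin n) : Fin (2 * n) := ⟨2 * (j : ℕ) + 1, by have := j.isLt; omega⟩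

lemma eq_evenPos_or_oddPos (i : Fin (2 * n)) : ∃ j : Fin n, i = evenPos j ∨ i = oddPos j := by
  refine ⟨⟨i / 2, by omega⟩, ?_⟩
  simp only [evenPos, oddPos, Fin.ext_iff]
  omega

lemma mem_Bset {m : ℕ} {b : Perm (Fin (2 * n))} : b ∈ Bset n m ↔
    (∀ i j : Fin (2 * n), (i : ℕ) < j → (j : ℕ) < 2 * m → b i < b j) ∧
    (∀ j : Fin n, m ≤ (j : ℕ) → b (evenPos j) < b (oddPos j)) ∧
    (∀ j k : Fin n, m ≤ (j : ℕ) → (j : ℕ) < k → b (evenPos j) < b (evenPos k)) := by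
  simp only [Bset, Finset.mem_filter, Finset.mem_univ, true_and]
  rfl

/-- The involution fixing the first `2 * m` positions and exchanging the two positions of
every later pair. -/
def pairSwap (n m : ℕ) : Perm (Fin (2 * n)) :=
  Function.Involutive.toPerm
    (fun i => if (i : ℕ) < 2 * m then i else if h : (i : ℕ) % 2 = 0 then ⟨i + 1, by omega⟩
      else ⟨i - 1, by omega⟩) (by
    intro i
    by_cases h1 : (i : ℕ) < 2 * m
    · simp [h1]
    by_cases h2 : (i : ℕ) % 2 = 0
    · simp only [h1, h2, if_false, dif_pos]
      rw [if_neg (by omega), dif_neg (by omega)]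
      simp
    · simp only [h1, h2, if_false, dif_neg, not_false_eq_true]
      rw [if_neg (by omega), dif_pos (by omega)]
      ext; simp; omega)

variable {m : ℕ}

lemma pairSwap_of_lt {i : Fin (2 * n)} (h : (i : ℕ) < 2 * m) : pairSwap n m i = i :=
  if_pos h

lemma pairSwap_evenPos {j : Fin n} (h : m ≤ (j : ℕ)) :
    pairSwap n m (evenPos j) = oddPos j := by
  have h1 : ¬ 2 * (j : ℕ) < 2 * m := by omega
  refine (if_neg h1).trans ((dif_pos ?_).trans rfl)
  simp [evenPos]

lemma pairSwap_oddPos {j : Fin n} (h : m ≤ (j : ℕ)) :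
    pairSwap n m (oddPos j) = evenPos j := by
  rw [← pairSwap_evenPos h]
  exact Function.Involutive.toPerm_involutive _ _

lemma pairSwap_mul_self : pairSwap n m * pairSwap n m = 1 := by
  ext i
  exact congrArg Fin.val (Function.Involutive.toPerm_involutive _ i)

/-- The involution of the partial matching described by an arrangement `b` of the positions. -/
def matchingInvolution (m : ℕ) (b : Perm (Fin (2 * n))) : Perm (Fin (2 * n)) :=
  b * pairSwap n m * b⁻¹

lemma matchingInvolution_apply (b : Perm (Fin (2 * n))) (i : Fin (2 * n)) :
    matchingInvolution m b (b i) = b (pairSwap n m i) := by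
  simp [matchingInvolution]

lemma matchingInvolution_mul_self (b : Perm (Fin (2 * n))) :
    matchingInvolution m b * matchingInvolution m b = 1 := by
  calc _ = b * (pairSwap n m * pairSwap n m) * b⁻¹ := by rw [matchingInvolution]; group
    _ = 1 := by rw [pairSwap_mul_self]; group

lemma mem_take_finRange {N k : ℕ} {i : Fin N} : i ∈ (List.finRange N).take k ↔ (i : ℕ) < k := by
  rw [List.mem_take_iff_getElem]
  constructor
  · rintro ⟨j, hj, rfl⟩
    simp at hj ⊢
    omega
  · intro h
    exact ⟨i, by simp [h], by simp⟩

lemma mem_drop_finRange {N k : ℕ} {i : Fin N} : i ∈ (List.finRange N).drop k ↔ k ≤ (i : ℕ) := by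
  rw [List.mem_drop_iff_getElem]
  constructor
  · rintro ⟨j, hj, rfl⟩
    simp
  · intro h
    exact ⟨i - k, by simp; omega, by ext; simp; omega⟩

lemma fixList_matchingInvolution {b : Perm (Fin (2 * n))} (hb : b ∈ Bset n m) :
    fixList (matchingInvolution m b) = ((List.finRange (2 * n)).take (2 * m)).map b := by
  rw [mem_Bset] at hb
  refine List.Pairwise.eq_of_mem_iff (r := (· < ·)) (pairwise_fixList _) ?_ ?_
  · rw [List.pairwise_map]
    refine (List.sortedLT_finRange _).pairwise.take.imp_of_mem fun {i j} _ hj hij => ?_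
    exact hb.1 i j hij (mem_take_finRange.1 hj)
  · intro x
    obtain ⟨y, rfl⟩ := b.surjective x
    rw [mem_fixList, matchingInvolution_apply, List.mem_map_of_injective b.injective,
      mem_take_finRange, b.injective.eq_iff]
    refine ⟨fun h => ?_, pairSwap_of_lt⟩
    by_contra hlt
    obtain ⟨j, rfl | rfl⟩ := eq_evenPos_or_oddPos y
    · rw [pairSwap_evenPos (by simp [evenPos] at hlt; omega)] at h
      simp [evenPos, oddPos] at h
    · rw [pairSwap_oddPos (by simp [oddPos] at hlt; omega)] at h
      simp [evenPos, oddPos] at h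

lemma leadList_matchingInvolution {b : Perm (Fin (2 * n))} (hb : b ∈ Bset n m) :
    leadList (matchingInvolution m b) =
      ((List.finRange n).drop m).map fun j => b (evenPos j) := by
  rw [mem_Bset] at hb
  refine List.Pairwise.eq_of_mem_iff (r := (· < ·)) (pairwise_leadList _) ?_ ?_
  · rw [List.pairwise_map]
    refine (List.sortedLT_finRange _).pairwise.drop.imp_of_mem fun {i j} hi _ hij => ?_
    exact hb.2.2 i j (mem_drop_finRange.1 hi) hij
  · intro x
    obtain ⟨y, rfl⟩ := b.surjective x
    simp only [mem_leadList, matchingInvolution_apply, List.mem_map, mem_drop_finRange,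
      b.injective.eq_iff]
    constructor
    · intro h
      by_cases hlt : (y : ℕ) < 2 * m
      · simp [pairSwap_of_lt hlt] at h
      obtain ⟨j, rfl | rfl⟩ := eq_evenPos_or_oddPos y
      · exact ⟨j, by simp [evenPos] at hlt; omega, rfl⟩
      · have hj : m ≤ (j : ℕ) := by simp [oddPos] at hlt; omega
        rw [pairSwap_oddPos hj] at h
        exact absurd h (hb.2.1 j hj).not_gt
    · rintro ⟨j, hj, rfl⟩
      rw [pairSwap_evenPos hj]
      exact hb.2.1 j hj

lemma matchingInvolution_injective {m' : ℕ} {b b' : Perm (Fin (2 * n))} (hm : m ≤ n)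
    (hm' : m' ≤ n) (hb : b ∈ Bset n m) (hb' : b' ∈ Bset n m')
    (h : matchingInvolution m b = matchingInvolution m' b') : m = m' ∧ b = b' := by
  have hF := fixList_matchingInvolution hb
  rw [h, fixList_matchingInvolution hb'] at hF
  have hlen := congrArg List.length hF
  simp only [List.length_map, List.length_take, List.length_finRange] at hlen
  obtain rfl : m = m' := by omega
  have hP := leadList_matchingInvolution hb
  rw [h, leadList_matchingInvolution hb'] at hP
  rw [List.map_inj_left] at hF hP
  refine ⟨rfl, Equiv.ext fun i => ?_⟩
  by_cases hlt : (i : ℕ) < 2 * m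
  · exact (hF i (mem_take_finRange.2 hlt)).symm
  obtain ⟨j, rfl | rfl⟩ := eq_evenPos_or_oddPos i
  · exact (hP j (mem_drop_finRange.2 (by simp [evenPos] at hlt; omega))).symm
  · have hj : m ≤ (j : ℕ) := by simp [oddPos] at hlt; omega
    rw [← pairSwap_evenPos hj, ← matchingInvolution_apply, ← matchingInvolution_apply, h,
      hP j (mem_drop_finRange.2 hj)]

lemma exists_matchingInvolution_eq {s : Perm (Fin (2 * n))} (hs : s * s = 1) :
    ∃ m ≤ n, ∃ b ∈ Bset n m, matchingInvolution m b = s := by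
  have hss (i : Fin (2 * n)) : s (s i) = i := by rw [← Perm.mul_apply, hs, Perm.one_apply]
  have hlen := length_fixList_add hs
  obtain ⟨m, hm⟩ : ∃ m, m + (leadList s).length = n := ⟨n - (leadList s).length, by omega⟩
  have hF : (fixList s).length = 2 * m := by omega
  let f : Fin (2 * n) → Fin (2 * n) := fun i =>
    if h : (i : ℕ) < 2 * m then (fixList s)[(i : ℕ)]
    else if (i : ℕ) % 2 = 0 then (leadList s)[(i : ℕ) / 2 - m]
    else s (leadList s)[(i : ℕ) / 2 - m]
  have hf (i : Fin (2 * n)) (h : (i : ℕ) < 2 * m) : f i = (fixList s)[(i : ℕ)] := dif_pos h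
  have hfe (j : Fin n) (h : m ≤ (j : ℕ)) : f (evenPos j) = (leadList s)[(j : ℕ) - m] := by
    have h1 : ¬ (2 * (j : ℕ) < 2 * m) := by omega
    simp [f, evenPos, h1]
  have hfo (j : Fin n) (h : m ≤ (j : ℕ)) : f (oddPos j) = s (leadList s)[(j : ℕ) - m] := by
    have h1 : ¬ (2 * (j : ℕ) + 1 < 2 * m) := by omega
    have h2 : (2 * (j : ℕ) + 1) / 2 - m = j - m := by omega
    simp [f, oddPos, h1, h2]
  have hsurj : Function.Surjective f := by
    intro x
    rcases lt_trichotomy x (s x) with h | h | h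
    · obtain ⟨k, hk, rfl⟩ := List.getElem_of_mem (mem_leadList.2 h)
      refine ⟨evenPos ⟨k + m, by omega⟩, ?_⟩
      rw [hfe _ (by simp)]
      simp
    · obtain ⟨k, hk, rfl⟩ := List.getElem_of_mem (mem_fixList.2 h.symm)
      exact ⟨⟨k, by omega⟩, hf _ (by simp; omega)⟩
    · obtain ⟨k, hk, he⟩ := List.getElem_of_mem ((mem_leadList (s := s) (i := s x)).2 (by rwa [hss]))
      refine ⟨oddPos ⟨k + m, by omega⟩, ?_⟩
      rw [hfo _ (by simp), ← hss x, ← he]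
      simp
  let b : Perm (Fin (2 * n)) := Equiv.ofBijective f hsurj.bijective_of_finite
  have hb (i : Fin (2 * n)) : b i = f i := rfl
  refine ⟨m, by omega, b, mem_Bset.2 ⟨?_, ?_, ?_⟩, ?_⟩
  · intro i j hij hj
    rw [hb, hb, hf i (by omega), hf j hj]
    exact List.pairwise_iff_getElem.1 (pairwise_fixList s) _ _ _ _ hij
  · intro j hj
    rw [hb, hb, hfe j hj, hfo j hj]
    exact mem_leadList.1 (List.getElem_mem _)
  · intro j k hj hjk
    rw [hb, hb, hfe j hj, hfe k (by omega)]
    exact List.pairwise_iff_getElem.1 (pairwise_leadList s) _ _ _ _ (by omega)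
  · refine Equiv.ext fun x => ?_
    obtain ⟨i, rfl⟩ := b.surjective x
    rw [matchingInvolution_apply]
    by_cases hlt : (i : ℕ) < 2 * m
    · rw [pairSwap_of_lt hlt, hb, hf i hlt]
      exact (mem_fixList.1 (List.getElem_mem _)).symm
    obtain ⟨j, rfl | rfl⟩ := eq_evenPos_or_oddPos i
    · have hj : m ≤ (j : ℕ) := by simp [evenPos] at hlt; omega
      rw [pairSwap_evenPos hj, hb, hb, hfe j hj, hfo j hj]
    · have hj : m ≤ (j : ℕ) := by simp [oddPos] at hlt; omega
      rw [pairSwap_oddPos hj, hb, hb, hfe j hj, hfo j hj, hss]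

/-- The sets `Bset n m`, for `m ≤ n`, parametrize the involutions of the `2 * n` positions. -/
lemma sum_Bset_eq_sum_involutions {M : Type*} [AddCommMonoid M]
    (f : ℕ → Perm (Fin (2 * n)) → M) (g : Perm (Fin (2 * n)) → M)
    (h : ∀ m ≤ n, ∀ b ∈ Bset n m, f m b = g (matchingInvolution m b)) :
    ∑ m ∈ Finset.range (n + 1), ∑ b ∈ Bset n m, f m b =
      ∑ s : Perm (Fin (2 * n)) with s * s = 1, g s := by
  rw [Finset.sum_sigma']
  refine Finset.sum_bij (fun x _ => matchingInvolution x.1 x.2) ?_ ?_ ?_ ?_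
  · intro x _
    exact Finset.mem_filter.2 ⟨Finset.mem_univ _, matchingInvolution_mul_self x.2⟩
  · rintro ⟨m, b⟩ hx ⟨m', b'⟩ hx' he
    simp only [Finset.mem_sigma, Finset.mem_range, Nat.lt_succ_iff] at hx hx'
    obtain ⟨rfl, rfl⟩ := matchingInvolution_injective hx.1 hx'.1 hx.2 hx'.2 he
    rfl
  · intro s hs
    obtain ⟨m, hm, b, hb, rfl⟩ := exists_matchingInvolution_eq (Finset.mem_filter.1 hs).2
    exact ⟨⟨m, b⟩, by simp [hb]; omega, rfl⟩
  · rintro ⟨m, b⟩ hx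
    simp only [Finset.mem_sigma, Finset.mem_range, Nat.lt_succ_iff] at hx
    exact h m hx.1 b hx.2

lemma prod_lead_eq_prod_list {N : ℕ} {R : Type*} [CommMonoid R] (s : Perm (Fin N))
    (g : Fin N → R) : ∏ i with i < s i, g i = ((leadList s).map g).prod := by
  rw [← List.prod_toFinset g ((pairwise_leadList s).imp ne_of_lt)]
  refine Finset.prod_congr ?_ fun _ _ => rfl
  ext; simp [mem_leadList]

end Involution

lemma NBlock_mul_Dprod_eq_matchingTerm {A : Type*} [Ring A] {n m : ℕ}
    (psiP psiM : Fin (2 * n) → A) (t : Fin (2 * n) → ℝ)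
    (D : Fin (2 * n) → Fin (2 * n) → Subring.center A)
    (hD : ∀ i j, (D i j : A) = D2 psiP psiM t i j) (a : Perm (Fin (2 * n)))
    {b : Perm (Fin (2 * n))} (hb : b ∈ Bset n m) :
    NBlock psiP psiM (b.trans a) m * Dprod psiP psiM t (b.trans a) m =
      matchingTerm (Nord psiP psiM) D a (matchingInvolution m b) := by
  have hDprod : Dprod psiP psiM t (b.trans a) m =
      ((∏ i with i < matchingInvolution m b i,
        D (a i) (a (matchingInvolution m b i)) : Subring.center A) : A) := by
    rw [prod_lead_eq_prod_list, leadList_matchingInvolution hb, List.map_map,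
      ← Subring.subtype_apply, map_list_prod, List.map_map, Dprod]
    congr 1
    refine List.map_congr_left fun j hj => ?_
    simp only [Function.comp_apply, Subring.subtype_apply, hD, matchingInvolution_apply,
      pairSwap_evenPos (mem_drop_finRange.1 hj)]
    rfl
  rw [matchingTerm, fixList_matchingInvolution hb, List.map_map, hDprod, Subring.smul_def,
    smul_eq_mul, NBlock]
  exact (Subring.mem_center_iff.1 (SetLike.coe_mem _) _)

/-- **Paper's Lemma 4.**  If all part-commutators are central (the contraction is a
c-number) and the times are pairwise distinct, then
`S(a) := Σ_{m=0}^{n} Σ_{b ∈ B_m} N(a(b(1)),…,a(b(2m)))·∏_{j=m+1}^{n} D(a(b(2j−1)),a(b(2j)))`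
takes the same value for any two permutations `a`, `a'` of `{1,…,2n}`. -/
theorem stmt_10 {A : Type*} [Ring A] (n : ℕ)
    (psiP psiM : Fin (2 * n) → A) (t : Fin (2 * n) → ℝ) (ht : Function.Injective t)
    (hpp : ∀ i j : Fin (2 * n), psiP i * psiP j - psiP j * psiP i ∈ Set.center A)
    (hpm : ∀ i j : Fin (2 * n), psiP i * psiM j - psiM j * psiP i ∈ Set.center A)
    (hmp : ∀ i j : Fin (2 * n), psiM i * psiP j - psiP j * psiM i ∈ Set.center A)
    (hmm : ∀ i j : Fin (2 * n), psiM i * psiM j - psiM j * psiM i ∈ Set.center A)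
    (a a' : Equiv.Perm (Fin (2 * n))) :
    ∑ m ∈ Finset.range (n + 1), ∑ b ∈ Bset n m,
        NBlock psiP psiM (b.trans a) m * Dprod psiP psiM t (b.trans a) m =
      ∑ m ∈ Finset.range (n + 1), ∑ b ∈ Bset n m,
        NBlock psiP psiM (b.trans a') m * Dprod psiP psiM t (b.trans a') m := by
  let D : Fin (2 * n) → Fin (2 * n) → Subring.center A := fun i j =>
    ⟨D2 psiP psiM t i j, D2_mem_center psiP psiM t hpp hpm hmm i j⟩
  let c : Fin (2 * n) → Fin (2 * n) → Subring.center A := fun i j =>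
    ⟨psiP i * psiP j - psiP j * psiP i + (psiM i * psiM j - psiM j * psiM i),
      Set.add_mem_center (hpp i j) (hmm i j)⟩
  have hF (L₁ L₂ : List (Fin (2 * n))) (x y : Fin (2 * n)) :
      Nord psiP psiM (L₁ ++ x :: y :: L₂) =
        Nord psiP psiM (L₁ ++ y :: x :: L₂) + c x y • Nord psiP psiM (L₁ ++ L₂) := by
    simp only [Nord_eq_nordAround]
    exact nordAround_swap psiP psiM (hpp x y) (hmm x y) L₁ L₂ 1
  have hD (x y : Fin (2 * n)) (h : x ≠ y) : D y x = D x y + c x y :=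
    Subtype.ext (D2_swap psiP psiM t ht h)
  have key (a : Perm (Fin (2 * n))) :
      ∑ m ∈ Finset.range (n + 1), ∑ b ∈ Bset n m,
        NBlock psiP psiM (b.trans a) m * Dprod psiP psiM t (b.trans a) m =
      ∑ s : Perm (Fin (2 * n)) with s * s = 1, matchingTerm (Nord psiP psiM) D id s := by
    rw [sum_Bset_eq_sum_involutions _ (matchingTerm (Nord psiP psiM) D a) fun m _ b hb =>
      NBlock_mul_Dprod_eq_matchingTerm psiP psiM t D (fun _ _ => rfl) a hb]
    exact sum_matchingTerm_comp_perm (Nord psiP psiM) D c hF hD a id Function.injective_id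
  rw [key a, key a']
end

section
/- (General permutation-averaged form of Wick's theorem, paper's equation (p7).) Let A be an associative algebra over ℚ, let {ψᵢ = ψᵢ⁺ + ψᵢ⁻ : i = 1,...,2n} be fields in A with pairwise distinct times, and suppose every commutator [ψᵢ^ε, ψⱼ^δ] with ε, δ ∈ {+,−} lies in the center of A (the contraction is a c-number). Then T(1, 2, ..., 2n) = Σ_{m=0}^{n} (1/((2m)!·(n−m)!·2^{n−m})) • Σ_{a ∈ S_{2n}} N(a(1),...,a(2m)) · ∏_{j=m+1}^{n} D(a(2j−1), a(2j)), where S_{2n} is the group of permutations of {1,...,2n}. -/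
section ExpSeries
open PowerSeries
variable {B R : Type*} [CommRing B] [Ring R] [Algebra B R]

theorem add_smul_pow_of_sq_eq_zero {x : B} (hx : x * x = 0) {a b c : R}
    (hc : a * b - b * a = c) (hcen : c ∈ Subalgebra.center B R) (n : ℕ) :
    (a + x • b) ^ (n + 1) =
      a ^ (n + 1) + x • ((n + 1) • (a ^ n * b) - (n + 1).choose 2 • (a ^ (n - 1) * c)) := by
  have hba : b * a = a * b - c := by rw [← hc]; abel
  have hca : c * a = a * c := (Subalgebra.mem_center_iff.1 hcen a).symm
  have hxx : ∀ r : R, x • x • r = 0 := fun r => by rw [smul_smul, hx, zero_smul]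
  induction n with
  | zero => simp
  | succ n ih =>
    rw [pow_succ, ih, Nat.choose_succ_succ' (n + 1) 1, Nat.choose_one_right]
    rcases n with _ | n
    · simp only [mul_add, add_mul, smul_mul_assoc, mul_smul_comm, smul_sub, sub_mul]
      simp [pow_two, hba, hxx, two_mul]
      module
    · simp only [mul_add, add_mul, smul_mul_assoc, mul_smul_comm, sub_mul, mul_assoc,
        hba, hca, mul_sub, pow_succ, Nat.add_sub_cancel, smul_sub, smul_add,
        smul_comm x (_ : ℕ), hxx, smul_zero]
      module

theorem mul_pow_eq_pow_mul_add {a b c : R} (hc : b * a - a * b = c)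
    (hcen : c ∈ Subalgebra.center B R) (n : ℕ) :
    b * a ^ (n + 1) = a ^ (n + 1) * b + (n + 1) • (a ^ n * c) := by
  have hba : b * a = a * b + c := by rw [← hc]; abel
  have hca : c * a = a * c := (Subalgebra.mem_center_iff.1 hcen a).symm
  induction n with
  | zero => simp [hba]
  | succ n ih =>
    rw [pow_succ _ (n + 1), ← mul_assoc, ih]
    simp only [add_mul, smul_mul_assoc, mul_assoc, hba, hca, mul_add, pow_succ]
    module

theorem commute_C_of_mem_center {k : R} (hk : k ∈ Subalgebra.center B R) (f : R⟦X⟧) :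
    C k * f = f * C k := by
  ext n
  rw [coeff_C_mul, coeff_mul_C, Subalgebra.mem_center_iff.1 hk]

variable [Algebra ℚ R]

/-- The exponential series `∑ zⁿ aⁿ / n!`. -/
noncomputable def expSeries (a : R) : R⟦X⟧ := PowerSeries.mk fun n => (n.factorial : ℚ)⁻¹ • a ^ n

/-- The series `exp (z² d)`. -/
noncomputable def expSqSeries (d : R) : R⟦X⟧ :=
  PowerSeries.mk fun n => if Even n then ((n / 2).factorial : ℚ)⁻¹ • d ^ (n / 2) else 0

theorem C_mul_expSeries {a b c : R} (hc : b * a - a * b = c)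
    (hcen : c ∈ Subalgebra.center B R) (x : B) :
    C (x • b) * expSeries a = expSeries a * (C (x • b) + C (x • c) * X) := by
  have key := mul_pow_eq_pow_mul_add hc hcen
  ext n
  rw [mul_add, map_add, ← mul_assoc]
  rcases n with _ | n
  · simp [expSeries, coeff_zero_mul_X, -coeff_zero_eq_constantCoeff, coeff_C_mul, coeff_mul_C]
  · rw [coeff_succ_mul_X, coeff_mul_C, coeff_C_mul, coeff_mul_C]
    simp only [expSeries, coeff_mk, mul_smul_comm, smul_mul_assoc, key]
    have h1 : ((n + 1).factorial : ℚ) = (n + 1) * n.factorial := by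
      rw [Nat.factorial_succ]; push_cast; ring
    have h0 : (n.factorial : ℚ) ≠ 0 := by exact_mod_cast n.factorial_ne_zero
    have h0' : (n : ℚ) + 1 ≠ 0 := by positivity
    rw [← Nat.cast_smul_eq_nsmul ℚ, h1]
    simp only [smul_add, smul_smul, smul_comm x (_ : ℚ)]
    congr 2
    push_cast; field_simp

theorem commute_expSqSeries {d : R} (hd : d ∈ Subalgebra.center B R) (f : R⟦X⟧) :
    expSqSeries d * f = f * expSqSeries d := by
  ext n
  rw [coeff_mul, coeff_mul, ← Finset.Nat.sum_antidiagonal_swap]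
  refine Finset.sum_congr rfl fun i _ => ?_
  simp only [expSqSeries, coeff_mk, Prod.fst_swap, Prod.snd_swap]
  split_ifs
  · rw [smul_mul_assoc, mul_smul_comm, Subalgebra.mem_center_iff.1 (pow_mem hd _)]
  · simp

theorem expSqSeries_add_smul {x : B} (hx : x * x = 0) {d c : R}
    (hcen : c ∈ Subalgebra.center B R) :
    expSqSeries (d + x • c) = expSqSeries d * (1 + C (x • c) * X ^ 2) := by
  have key := add_smul_pow_of_sq_eq_zero hx (a := d) (b := c) (c := 0)
    (sub_eq_zero.2 (Subalgebra.mem_center_iff.1 hcen d)) (zero_mem _)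
  ext n
  rw [mul_add, mul_one, ← mul_assoc, map_add]
  rcases n with _ | _ | n
  · simp [expSqSeries, coeff_mul_X_pow', -coeff_zero_eq_constantCoeff]
  · rw [coeff_mul_X_pow', if_neg (by norm_num)]
    simp [expSqSeries]
  · rw [show n + 1 + 1 = n + 2 from rfl, coeff_mul_X_pow, coeff_mul_C]
    simp only [expSqSeries, coeff_mk, Nat.even_add, even_two, iff_true]
    split_ifs with h
    · rw [show (n + 2) / 2 = n / 2 + 1 by omega, key]
      have h1 : ((n / 2 + 1).factorial : ℚ) = ((n / 2 : ℕ) + 1) * (n / 2).factorial := by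
        rw [Nat.factorial_succ]; push_cast; ring
      have h0 : ((n / 2).factorial : ℚ) ≠ 0 := by exact_mod_cast (n / 2).factorial_ne_zero
      have h0' : ((n / 2 : ℕ) : ℚ) + 1 ≠ 0 := by positivity
      rw [← Nat.cast_smul_eq_nsmul ℚ, h1]
      simp only [smul_add, mul_zero, smul_zero, sub_zero, mul_smul_comm, smul_mul_assoc, smul_smul,
        smul_comm x (_ : ℚ)]
      congr 2
      push_cast; field_simp
    · simp

theorem expSeries_add_smul {x : B} (hx : x * x = 0) {a b c : R}
    (hc : a * b - b * a = c) (hcen : c ∈ Subalgebra.center B R) :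
    expSeries (a + x • b) =
      expSeries a * (1 + C (x • b) * X - C ((1 / 2 : ℚ) • x • c) * X ^ 2) := by
  have key := add_smul_pow_of_sq_eq_zero hx hc hcen
  ext n
  rw [mul_sub, mul_add, mul_one, ← mul_assoc, ← mul_assoc, map_sub, map_add]
  rcases n with _ | _ | n
  · simp [expSeries, coeff_zero_mul_X, coeff_mul_X_pow', -coeff_zero_eq_constantCoeff]
  · rw [coeff_succ_mul_X, coeff_mul_C, coeff_mul_X_pow', if_neg (by norm_num)]
    simp [expSeries, -coeff_zero_eq_constantCoeff]
  · rw [coeff_succ_mul_X, coeff_mul_C, show n + 1 + 1 = n + 2 from rfl, coeff_mul_X_pow, coeff_mul_C]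
    simp only [expSeries, coeff_mk]
    rw [show n + 2 = (n + 1) + 1 from rfl, key]
    have h1 : ((n + 1).factorial : ℚ) = (n + 1) * n.factorial := by
      rw [Nat.factorial_succ]; push_cast; ring
    have h2 : ((n + 1 + 1).factorial : ℚ) = (n + 2) * ((n + 1) * n.factorial) := by
      rw [Nat.factorial_succ, ← h1]; push_cast; ring
    have h3 : ((n + 1 + 1).choose 2 : ℚ) = (n + 2) * (n + 1) / 2 := by
      rw [Nat.cast_choose_two]; push_cast; ring
    rw [← Nat.cast_smul_eq_nsmul ℚ, ← Nat.cast_smul_eq_nsmul ℚ ((n + 1 + 1).choose 2), h3, h1, h2]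
    have h0 : (n.factorial : ℚ) ≠ 0 := by exact_mod_cast n.factorial_ne_zero
    have h0' : (n : ℚ) + 1 ≠ 0 := by positivity
    have h0'' : (n : ℚ) + 2 ≠ 0 := by positivity
    simp only [smul_sub, smul_add, mul_smul_comm, smul_mul_assoc, smul_smul, smul_comm x (_ : ℚ),
      Nat.add_sub_cancel]
    rw [add_sub_assoc]
    congr 3
    · push_cast; field_simp; ring
    · field_simp

variable [Algebra ℚ B] [IsScalarTower ℚ B R]

theorem normalOrdered_series_step {x : B} (hx : x * x = 0) {am ap bm bp d c c₁ c₂ c₃ : R}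
    (h₁ : am * bm - bm * am = c₁) (h₂ : ap * bp - bp * ap = c₂) (h₃ : bm * ap - ap * bm = c₃)
    (h₁c : c₁ ∈ Subalgebra.center B R) (h₂c : c₂ ∈ Subalgebra.center B R)
    (h₃c : c₃ ∈ Subalgebra.center B R) (hd : d ∈ Subalgebra.center B R)
    (hc : c = (1 / 2 : ℚ) • c₁ + (1 / 2 : ℚ) • c₂ - c₃) :
    expSeries (am + x • bm) * expSeries (ap + x • bp) * expSqSeries (d + x • c) =
      expSeries am * expSeries ap * expSqSeries d * (1 + C (x • (bp + bm)) * X) := by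
  have half : ∀ {k : R}, k ∈ Subalgebra.center B R → (1 / 2 : ℚ) • k ∈ Subalgebra.center B R := by
    intro k hk
    rw [← algebraMap_smul B]
    exact Subalgebra.smul_mem _ hk _
  have hcc : c ∈ Subalgebra.center B R := by
    rw [hc]; exact sub_mem (add_mem (half h₁c) (half h₂c)) h₃c
  rw [expSeries_add_smul hx h₁ h₁c, expSeries_add_smul hx h₂ h₂c, expSqSeries_add_smul hx hcc]
  have zero : ∀ (k l : R) (m n : ℕ), C (x • k) * X ^ m * (C (x • l) * X ^ n) = 0 := by
    intro k l m n
    rw [mul_assoc, ← mul_assoc (X ^ m), (commute_X_pow (C (x • l)) m).eq.symm, mul_assoc,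
      ← mul_assoc (C (x • k)), ← map_mul, smul_mul_smul_comm, hx, zero_smul, map_zero, zero_mul]
  have zero' : ∀ (k l : R) (n : ℕ), C (x • k) * X * (C (x • l) * X ^ n) = 0 := by
    intro k l n; simpa using zero k l 1 n
  have zero'' : ∀ (k l : R) (n : ℕ), C (x • k) * X ^ n * (C (x • l) * X) = 0 := by
    intro k l n; simpa using zero k l n 1
  have e2X : ∀ f : R⟦X⟧, f * X = X * f := fun f => (commute_X f).eq
  have hU : C (x • bm) * X * expSeries ap =
      expSeries ap * (C (x • bm) * X + C (x • c₃) * X ^ 2) := by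
    rw [mul_assoc, ← e2X, ← mul_assoc, C_mul_expSeries h₃ h₃c]
    simp only [mul_add, add_mul, mul_assoc, pow_two]
  have hK : C (x • (1 / 2 : ℚ) • c₁) * X ^ 2 * expSeries ap =
      expSeries ap * (C (x • (1 / 2 : ℚ) • c₁) * X ^ 2) := by
    rw [mul_assoc, ← (commute_X_pow (expSeries ap) 2).eq, ← mul_assoc,
      commute_C_of_mem_center (Subalgebra.smul_mem _ (half h₁c) x), mul_assoc]
  have z1 : C (x • bm) * X * (C (x • bp) * X) = 0 := by simpa using zero bm bp 1 1
  rw [smul_comm (1 / 2 : ℚ) x c₁, smul_comm (1 / 2 : ℚ) x c₂]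
  set e₁ := expSeries am
  set e₂ := expSeries ap
  set e₃ := expSqSeries d with he₃
  have hsum : C (x • c₃) * X ^ 2 - C (x • (1 / 2 : ℚ) • c₁) * X ^ 2 -
      C (x • (1 / 2 : ℚ) • c₂) * X ^ 2 + C (x • c) * X ^ 2 = (0 : R⟦X⟧) := by
    rw [← sub_mul, ← sub_mul, ← add_mul, ← map_sub, ← map_sub, ← map_add, ← smul_sub, ← smul_sub,
      ← smul_add, hc, show ∀ u v w : R, u - v - w + (v + w - u) = 0 by intros; abel]
    simp
  calc e₁ * (1 + C (x • bm) * X - C (x • (1 / 2 : ℚ) • c₁) * X ^ 2) *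
        (e₂ * (1 + C (x • bp) * X - C (x • (1 / 2 : ℚ) • c₂) * X ^ 2)) *
        (e₃ * (1 + C (x • c) * X ^ 2))
      = e₁ * ((1 + C (x • bm) * X - C (x • (1 / 2 : ℚ) • c₁) * X ^ 2) * e₂) *
        ((1 + C (x • bp) * X - C (x • (1 / 2 : ℚ) • c₂) * X ^ 2) * e₃) *
        (1 + C (x • c) * X ^ 2) := by simp only [mul_assoc]
    _ = e₁ * (e₂ * (1 + C (x • bm) * X + C (x • c₃) * X ^ 2 - C (x • (1 / 2 : ℚ) • c₁) * X ^ 2)) *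
        (e₃ * (1 + C (x • bp) * X - C (x • (1 / 2 : ℚ) • c₂) * X ^ 2)) *
        (1 + C (x • c) * X ^ 2) := by
      rw [commute_expSqSeries hd, sub_mul, add_mul, hU, hK, one_mul]
      congr 3
      noncomm_ring
    _ = e₁ * e₂ * ((1 + C (x • bm) * X + C (x • c₃) * X ^ 2 - C (x • (1 / 2 : ℚ) • c₁) * X ^ 2) *
        e₃) * ((1 + C (x • bp) * X - C (x • (1 / 2 : ℚ) • c₂) * X ^ 2) *
        (1 + C (x • c) * X ^ 2)) := by simp only [mul_assoc]
    _ = e₁ * e₂ * e₃ * ((1 + C (x • bm) * X + C (x • c₃) * X ^ 2 -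
        C (x • (1 / 2 : ℚ) • c₁) * X ^ 2) *
        ((1 + C (x • bp) * X - C (x • (1 / 2 : ℚ) • c₂) * X ^ 2) *
        (1 + C (x • c) * X ^ 2))) := by
      rw [he₃, ← commute_expSqSeries hd]; simp only [mul_assoc]
    _ = e₁ * e₂ * e₃ * (1 + C (x • (bp + bm)) * X) := by
      congr 1
      simp only [add_mul, sub_mul, mul_add, mul_sub, one_mul, mul_one, zero, zero', zero'', z1,
        smul_add, map_add]
      refine sub_eq_zero.1 (Eq.trans ?_ hsum)
      abel

end ExpSeries

section TimeOrder
open PowerSeries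
variable {ι B R : Type*} [CommRing B] [Ring R] [Algebra B R]

theorem D2_mem_center_s12 {p q : ι → R} (t : ι → ℝ)
    (hpp : ∀ i j, p i * p j - p j * p i ∈ Subalgebra.center B R)
    (hpq : ∀ i j, p i * q j - q j * p i ∈ Subalgebra.center B R)
    (hqq : ∀ i j, q i * q j - q j * q i ∈ Subalgebra.center B R) (i j : ι) :
    D2 p q t i j ∈ Subalgebra.center B R := by
  unfold D2 T2 N2 psi
  split_ifs
  · convert hpq i j using 1
    noncomm_ring
  · convert add_mem (add_mem (hpp j i) (hqq j i)) (hpq j i) using 1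
    noncomm_ring

theorem D2_add_D2_of_lt (p q : ι → R) {t : ι → ℝ} {i j : ι} (h : t i < t j) :
    D2 p q t i j + D2 p q t j i =
      (q j * q i - q i * q j) + (p j * p i - p i * p j) - 2 * (q i * p j - p j * q i) := by
  unfold D2 T2 N2 psi
  rw [if_neg h.le.not_gt, if_pos h]
  noncomm_ring

theorem list_smul_sum_commutator (x : ι → B) (f : ι → R) (g : R) (l : List ι) :
    (l.map fun j => x j • f j).sum * g - g * (l.map fun j => x j • f j).sum =
      (l.map fun j => x j • (f j * g - g * f j)).sum := by
  induction l with
  | nil => simp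
  | cons a l ih =>
    rw [List.map_cons, List.map_cons, List.sum_cons, List.sum_cons, ← ih, add_mul, mul_add,
      smul_mul_assoc, mul_smul_comm, smul_sub]
    abel

theorem list_smul_sum_mem_center {x : ι → B} {f : ι → R}
    (hf : ∀ j, f j ∈ Subalgebra.center B R) (l : List ι) :
    (l.map fun j => x j • f j).sum ∈ Subalgebra.center B R := by
  refine list_sum_mem fun r hr => ?_
  obtain ⟨j, -, rfl⟩ := List.mem_map.1 hr
  exact Subalgebra.smul_mem _ (hf j) _

/-- The weighted sum `∑ xᵢ xⱼ D(i,j)` over all pairs of entries of a list. -/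
noncomputable def contractionSum (p q : ι → R) (t : ι → ℝ) (x : ι → B) (l : List ι) : R :=
  (l.map fun i => x i • (l.map fun j => x j • D2 p q t i j).sum).sum

theorem contractionSum_append_singleton (p q : ι → R) (t : ι → ℝ) {x : ι → B} {i : ι}
    (hx : x i * x i = 0) (l : List ι) :
    contractionSum p q t x (l ++ [i]) = contractionSum p q t x l +
      x i • (l.map fun j => x j • (D2 p q t i j + D2 p q t j i)).sum := by
  have h (l' : List ι) : (l'.map fun a => x a • (x i • D2 p q t a i)).sum =
      x i • (l'.map fun a => x a • D2 p q t a i).sum := by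
    rw [List.smul_sum, List.map_map]
    simp only [Function.comp_def, smul_comm (x i)]
  have hxx (r : R) : x i • x i • r = 0 := by rw [smul_smul, hx, zero_smul]
  simp only [contractionSum, List.map_append, List.sum_append, List.map_cons, List.map_nil,
    List.sum_singleton, smul_add, List.sum_map_add, h, hxx]
  abel

theorem coeff_length_prod_one_add (l : List R) :
    coeff l.length (l.map fun r => 1 + C r * X).prod = l.prod ∧
      ∀ n, l.length < n → coeff n (l.map fun r => 1 + C r * X).prod = 0 := by
  induction l with
  | nil => exact ⟨by simp, fun n hn => by simp [coeff_one, Nat.pos_iff_ne_zero.1 hn]⟩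
  | cons a l ih =>
    have h (n : ℕ) (f : R⟦X⟧) : coeff (n + 1) ((1 + C a * X) * f) =
        coeff (n + 1) f + a * coeff n f := by
      rw [add_mul, one_mul, mul_assoc, ← (commute_X f).eq, ← mul_assoc, map_add,
        coeff_succ_mul_X, coeff_C_mul]
    refine ⟨?_, fun n hn => ?_⟩
    · simp only [List.length_cons, List.map_cons, List.prod_cons, h, ih.1, ih.2 _ (Nat.lt_succ_self _),
        zero_add]
    · obtain ⟨n, rfl⟩ := Nat.exists_eq_succ_of_ne_zero (Nat.ne_zero_of_lt hn)
      rw [List.length_cons] at hn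
      rw [List.map_cons, List.prod_cons, Nat.succ_eq_add_one, h, ih.2 _ (by omega),
        ih.2 _ (by omega), mul_zero, add_zero]

variable [Algebra ℚ R] [Algebra ℚ B] [IsScalarTower ℚ B R]

theorem prod_one_add_eq_normalOrdered_series {p q : ι → R} {t : ι → ℝ} {x : ι → B}
    (hx : ∀ i, x i * x i = 0)
    (hpp : ∀ i j, p i * p j - p j * p i ∈ Subalgebra.center B R)
    (hpq : ∀ i j, p i * q j - q j * p i ∈ Subalgebra.center B R)
    (hqq : ∀ i j, q i * q j - q j * q i ∈ Subalgebra.center B R)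
    (l : List ι) (hl : l.Pairwise fun i j => t j < t i) :
    expSeries (l.map fun i => x i • q i).sum * expSeries (l.map fun i => x i • p i).sum *
        expSqSeries ((1 / 2 : ℚ) • contractionSum p q t x l) =
      (l.map fun i => 1 + C (x i • psi p q i) * X).prod := by
  have hqp : ∀ i j, q i * p j - p j * q i ∈ Subalgebra.center B R := fun i j => by
    rw [← neg_sub]; exact neg_mem (hpq j i)
  induction l using List.reverseRecOn with
  | nil =>
    have h1 : expSeries (0 : R) = 1 := by
      ext n
      rcases n with _ | n <;> simp [expSeries, coeff_one, -coeff_zero_eq_constantCoeff]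
    have h2 : expSqSeries (0 : R) = 1 := by
      ext n
      rcases n with _ | _ | n <;>
        simp [expSqSeries, coeff_one, -coeff_zero_eq_constantCoeff]
    simp [contractionSum, h1, h2]
  | append_singleton l i ih =>
    rw [List.pairwise_append] at hl
    have hD : (1 / 2 : ℚ) • contractionSum p q t x (l ++ [i]) =
        (1 / 2 : ℚ) • contractionSum p q t x l +
          x i • ((1 / 2 : ℚ) • (l.map fun j => x j • (D2 p q t i j + D2 p q t j i)).sum) := by
      rw [contractionSum_append_singleton p q t (hx i), smul_add, smul_comm (x i)]
    rw [hD]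
    simp only [List.map_append, List.sum_append, List.map_cons, List.map_nil, List.sum_singleton,
      List.prod_append, List.prod_singleton]
    rw [← ih hl.1]
    refine normalOrdered_series_step (hx i) (list_smul_sum_commutator x q (q i) l)
      (list_smul_sum_commutator x p (p i) l)
      (c₃ := (l.map fun j => x j • (q i * p j - p j * q i)).sum) ?_
      (list_smul_sum_mem_center (fun j => hqq _ _) l)
      (list_smul_sum_mem_center (fun j => hpp _ _) l)
      (list_smul_sum_mem_center (fun j => hqp _ _) l) ?_ ?_
    · rw [← neg_sub, list_smul_sum_commutator, List.sum_neg, List.map_map]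
      simp only [Function.comp_def, ← smul_neg, neg_sub]
    · rw [← algebraMap_smul B]
      exact Subalgebra.smul_mem _ (list_smul_sum_mem_center (fun i => list_smul_sum_mem_center
        (fun j => D2_mem_center_s12 t hpp hpq hqq i j) l) l) _
    · have hlt : ∀ j ∈ l, t i < t j := fun j hj => hl.2.2 j hj i (by simp)
      rw [List.map_congr_left fun j hj => by rw [D2_add_D2_of_lt p q (hlt j hj)]]
      clear hD ih hl hlt
      induction l with
      | nil => simp
      | cons j l ih =>
        have e (y : B) (u v w : R) : (1 / 2 : ℚ) • y • (u + v - 2 * w) =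
            (1 / 2 : ℚ) • y • u + (1 / 2 : ℚ) • y • v - y • w := by
          rw [smul_comm _ y, smul_comm _ y, smul_comm _ y, ← smul_add, ← smul_sub, two_mul]
          congr 1
          module
        simp only [List.map_cons, List.sum_cons]
        rw [smul_add, ih, e]
        simp only [smul_add]
        abel

theorem coeff_two_mul_normalOrdered_series (a b d : R) (n : ℕ) :
    coeff (2 * n) (expSeries a * expSeries b * expSqSeries ((1 / 2 : ℚ) • d)) =
      ∑ m ∈ Finset.range (n + 1), (((2 * m).factorial * (n - m).factorial * 2 ^ (n - m) : ℚ))⁻¹ •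
        ((∑ r ∈ Finset.HasAntidiagonal.antidiagonal (2 * m), (2 * m).choose r.1 • (a ^ r.1 * b ^ r.2)) *
          d ^ (n - m)) := by
  rw [coeff_mul, Finset.Nat.sum_antidiagonal_eq_sum_range_succ_mk]
  rw [Finset.sum_congr rfl (g := fun i => coeff i (expSeries a * expSeries b) *
    coeff (2 * n - i) (expSqSeries ((1 / 2 : ℚ) • d))) (fun _ _ => rfl)]
  have key (m : ℕ) : coeff m (expSeries a * expSeries b) = (m.factorial : ℚ)⁻¹ •
      ∑ r ∈ Finset.HasAntidiagonal.antidiagonal m, m.choose r.1 • (a ^ r.1 * b ^ r.2) := by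
    rw [coeff_mul, Finset.smul_sum]
    refine Finset.sum_congr rfl fun r hr => ?_
    rw [Finset.HasAntidiagonal.mem_antidiagonal] at hr
    subst hr
    simp only [expSeries, coeff_mk, smul_mul_smul_comm]
    rw [← Nat.cast_smul_eq_nsmul ℚ, smul_smul, Nat.cast_add_choose]
    congr 1
    have h1 : ((r.1 + r.2).factorial : ℚ) ≠ 0 := by exact_mod_cast Nat.factorial_ne_zero _
    have h2 : (r.1.factorial : ℚ) ≠ 0 := by exact_mod_cast Nat.factorial_ne_zero _
    have h3 : (r.2.factorial : ℚ) ≠ 0 := by exact_mod_cast Nat.factorial_ne_zero _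
    field_simp
  have e2 (m : ℕ) (hm : m ∈ Finset.range (n + 1)) :
      coeff (2 * n - 2 * m) (expSqSeries ((1 / 2 : ℚ) • d)) =
        ((n - m).factorial * 2 ^ (n - m) : ℚ)⁻¹ • d ^ (n - m) := by
    rw [expSqSeries, coeff_mk, ← Nat.mul_sub, if_pos (even_two_mul _),
      Nat.mul_div_cancel_left _ two_pos, smul_pow, smul_smul, mul_inv]
    simp
  rw [← Finset.sum_subset (s₁ := (Finset.range (n + 1)).image (2 * ·))]
  · rw [Finset.sum_image (fun _ _ _ _ h => Nat.eq_of_mul_eq_mul_left two_pos h)]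
    refine Finset.sum_congr rfl fun m hm => ?_
    rw [key, e2 m hm, smul_mul_smul_comm, ← mul_inv, mul_assoc]
  · intro i hi
    simp only [Finset.mem_image, Finset.mem_range] at hi ⊢
    omega
  · intro i hi hi'
    simp only [Finset.mem_image, Finset.mem_range] at hi hi'
    have : ¬ Even (2 * n - i) := by
      rintro ⟨r, hr⟩
      exact hi' ⟨n - r, by omega, by omega⟩
    rw [expSqSeries, coeff_mk, if_neg this, mul_zero]

end TimeOrder

section FunctionSums
variable {ι B R : Type*} [CommRing B] [Ring R] [Algebra B R]

theorem sum_list_prod_eq_list_prod_sum {κ : Type*} [Fintype κ] [DecidableEq κ] [Fintype ι]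
    (l : List κ) (hl : l.Nodup) (hmem : ∀ k, k ∈ l) (F : κ → ι → R) :
    ∑ v : κ → ι, (l.map fun j => F j (v j)).prod = (l.map fun j => ∑ i, F j i).prod := by
  have h := ((MultilinearMap.mkPiAlgebraFin ℤ l.length R).domDomCongr
    (hl.getEquivOfForallMemList l hmem)).map_sum F
  simp only [MultilinearMap.domDomCongr_apply, MultilinearMap.mkPiAlgebraFin_apply,
    List.Nodup.getEquivOfForallMemList_apply] at h
  have hget (g : κ → R) : (List.ofFn fun i => g (l.get i)) = l.map g := by
    conv_rhs => rw [← List.ofFn_get l, List.map_ofFn]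
    rfl
  rw [hget fun k => ∑ j, F k j] at h
  rw [h]
  exact Finset.sum_congr rfl fun v _ => by rw [← hget fun k => F k (v k)]

theorem Nord_ofFn (p q : ι → R) {M : ℕ} (v : Fin M → ι) :
    Nord p q (List.ofFn v) = ∑ S : Finset (Fin M),
      (((List.finRange M).filter fun j => decide (j ∈ S)).map fun j => q (v j)).prod *
        (((List.finRange M).filter fun j => decide (j ∉ S)).map fun j => p (v j)).prod := by
  have h (L : List ι) (K : ℕ) (hK : L.length = K) : Nord p q L = ∑ S : Finset (Fin K),
      (((List.finRange K).filter fun j => decide (j ∈ S)).map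
          fun j => q (L.get (j.cast hK.symm))).prod *
        (((List.finRange K).filter fun j => decide (j ∉ S)).map
          fun j => p (L.get (j.cast hK.symm))).prod := by
    subst hK
    rfl
  rw [h _ M List.length_ofFn]
  simp

theorem length_filter_finRange_mem {M : ℕ} (S : Finset (Fin M)) :
    ((List.finRange M).filter fun j => decide (j ∈ S)).length = S.card := by
  rw [← List.toFinset_card_of_nodup ((List.nodup_finRange M).filter _)]
  congr 1
  ext j
  simp

theorem sum_Nord_ofFn [Fintype ι] (p q : ι → R) (M : ℕ) :
    ∑ v : Fin M → ι, Nord p q (List.ofFn v) =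
      ∑ r ∈ Finset.HasAntidiagonal.antidiagonal M,
        M.choose r.1 • ((∑ i, q i) ^ r.1 * (∑ i, p i) ^ r.2) := by
  simp only [Nord_ofFn]
  rw [Finset.sum_comm, Finset.Nat.sum_antidiagonal_eq_sum_range_succ_mk]
  have h := Finset.sum_powerset_apply_card
    (fun m => (∑ i, q i) ^ m * (∑ i, p i) ^ (M - m)) (x := (Finset.univ : Finset (Fin M)))
  rw [Finset.card_univ, Fintype.card_fin, Finset.powerset_univ] at h
  refine Eq.trans (Finset.sum_congr rfl fun S _ => ?_) h
  have h1 := sum_list_prod_eq_list_prod_sum (ι := ι) (R := R)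
    (((List.finRange M).filter fun j => decide (j ∈ S)) ++
      ((List.finRange M).filter fun j => decide (j ∉ S)))
    (List.nodup_append'.2 ⟨(List.nodup_finRange M).filter _, (List.nodup_finRange M).filter _,
      fun j hj hj' => by simp_all⟩)
    (fun k => by simp [em]) (fun j i => if j ∈ S then q i else p i)
  have hq (g : Fin M → R) (g' : Fin M → R) :
      (((List.finRange M).filter fun j => decide (j ∈ S)).map fun j => if j ∈ S then g j else g' j) =
        ((List.finRange M).filter fun j => decide (j ∈ S)).map g :=
    List.map_congr_left fun j hj => if_pos (by simpa using hj)
  have hp (g : Fin M → R) (g' : Fin M → R) :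
      (((List.finRange M).filter fun j => decide (j ∉ S)).map fun j => if j ∈ S then g j else g' j) =
        ((List.finRange M).filter fun j => decide (j ∉ S)).map g' :=
    List.map_congr_left fun j hj => if_neg (by simpa using hj)
  have hite (j : Fin M) : (∑ i, if j ∈ S then q i else p i) =
      if j ∈ S then ∑ i, q i else ∑ i, p i := by split_ifs <;> rfl
  have hcompl : ((List.finRange M).filter fun j => decide (j ∉ S)).length = M - S.card := by
    have := length_filter_finRange_mem Sᶜ
    rw [Finset.card_compl, Fintype.card_fin] at this
    simpa using this
  simp only [List.map_append, List.prod_append, hite, hq, hp, List.map_const', List.prod_replicate,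
    length_filter_finRange_mem, hcompl] at h1
  exact h1

theorem list_prod_map_smul {κ : Type*} (x : κ → B) (f : κ → R) (l : List κ) :
    (l.map fun j => x j • f j).prod = (l.map x).prod • (l.map f).prod := by
  induction l with
  | nil => simp
  | cons a l ih => simp only [List.map_cons, List.prod_cons, ih, smul_mul_smul_comm]

theorem list_prod_filter_mul_prod_filter_not {κ : Type*} (P : κ → Prop) [DecidablePred P]
    (x : κ → B) (l : List κ) :
    ((l.filter fun j => decide (P j)).map x).prod * ((l.filter fun j => decide (¬ P j)).map x).prod =
      (l.map x).prod := by
  induction l with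
  | nil => simp
  | cons a l ih =>
    by_cases h : P a
    · simp [h, mul_assoc, ← ih]
    · simp [h, mul_left_comm, ← ih]

theorem Nord_smul (p q : ι → R) (x : ι → B) {M : ℕ} (v : Fin M → ι) :
    Nord (fun i => x i • p i) (fun i => x i • q i) (List.ofFn v) =
      (∏ j, x (v j)) • Nord p q (List.ofFn v) := by
  rw [Nord_ofFn, Nord_ofFn, Finset.smul_sum]
  refine Finset.sum_congr rfl fun S _ => ?_
  rw [list_prod_map_smul (fun j => x (v j)), list_prod_map_smul (fun j => x (v j)),
    smul_mul_smul_comm, list_prod_filter_mul_prod_filter_not, Fin.prod_univ_def]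

theorem sum_prod_pairs [Fintype ι] (D : ι → ι → R) (k : ℕ) :
    ∑ w : Fin k → Fin 2 → ι, (List.ofFn fun j => D (w j 0) (w j 1)).prod =
      (∑ i, ∑ j, D i j) ^ k := by
  have h := sum_list_prod_eq_list_prod_sum (List.finRange k) (List.nodup_finRange k)
    List.mem_finRange (fun _ (u : Fin 2 → ι) => D (u 0) (u 1))
  simp only [List.map_const', List.prod_replicate, List.length_finRange] at h
  simp only [List.ofFn_eq_map]
  rw [h, ← (finTwoArrowEquiv ι).symm.sum_comp, Fintype.sum_prod_type]
  simp [finTwoArrowEquiv]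

theorem sum_perm_eq_sum_fun {N : ℕ} {x : Fin N → B} (hx : ∀ i, x i * x i = 0)
    (F : (Fin N → Fin N) → R) :
    ∑ a : Equiv.Perm (Fin N), (∏ i, x i) • F a = ∑ v : Fin N → Fin N, (∏ i, x (v i)) • F v := by
  refine Finset.sum_of_injOn (fun a : Equiv.Perm (Fin N) => (a : Fin N → Fin N))
    (DFunLike.coe_injective.injOn) (by simp) ?_ ?_
  · intro v _ hv
    have hinj : ¬ Function.Injective v := fun h =>
      hv ⟨Equiv.ofBijective v (Finite.injective_iff_bijective.1 h), by simp, by ext; simp⟩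
    obtain ⟨i, j, hij, hne⟩ : ∃ i j, v i = v j ∧ i ≠ j := by
      simpa [Function.Injective] using hinj
    rw [← Finset.mul_prod_erase _ _ (Finset.mem_univ i),
      ← Finset.mul_prod_erase _ _ (Finset.mem_erase.2 ⟨hne.symm, Finset.mem_univ j⟩), ← mul_assoc,
      hij, hx, zero_mul, zero_smul]
  · intro a _
    rw [Equiv.prod_comp a x]

/-- Positions `0, …, 2n-1` split into the first `2m` and `n - m` consecutive pairs. -/
noncomputable def blockPairEquiv {n m : ℕ} (hm : m ≤ n) :
    Fin (2 * m) ⊕ Fin (n - m) × Fin 2 ≃ Fin (2 * n) :=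
  Equiv.ofBijective
    (Sum.elim (fun i => ⟨i, by omega⟩) (fun jb => ⟨2 * (m + jb.1) + jb.2, by omega⟩)) <| by
    rw [Fintype.bijective_iff_injective_and_card]
    constructor
    · rintro (i | ⟨j, b⟩) (i' | ⟨j', b'⟩) h <;>
        simp only [Sum.elim_inl, Sum.elim_inr, Sum.inl.injEq, Sum.inr.injEq,
          Prod.mk.injEq, Fin.ext_iff, reduceCtorEq] at h ⊢ <;> omega
    · simp
      omega

theorem sum_perm_normalOrdered {n m : ℕ} (hm : m ≤ n) {x : Fin (2 * n) → B}
    (hx : ∀ i, x i * x i = 0) (p q : Fin (2 * n) → R) (t : Fin (2 * n) → ℝ) :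
    (∏ i, x i) • ∑ a : Equiv.Perm (Fin (2 * n)), NBlock p q a m * Dprod p q t a m =
      (∑ r ∈ Finset.HasAntidiagonal.antidiagonal (2 * m), (2 * m).choose r.1 •
        ((∑ i, x i • q i) ^ r.1 * (∑ i, x i • p i) ^ r.2)) *
      (∑ i, ∑ j, (x i * x j) • D2 p q t i j) ^ (n - m) := by
  rw [← sum_Nord_ofFn, ← sum_prod_pairs, Finset.smul_sum, Finset.sum_mul_sum]
  refine (sum_perm_eq_sum_fun hx fun v =>
    Nord p q (((List.finRange (2 * n)).take (2 * m)).map v) *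
      (((List.finRange n).drop m).map fun j : Fin n =>
        D2 p q t (v ⟨2 * (j : ℕ), by omega⟩) (v ⟨2 * (j : ℕ) + 1, by omega⟩)).prod).trans ?_
  rw [← ((blockPairEquiv hm).arrowCongr (Equiv.refl (Fin (2 * n)))).sum_comp,
    ← (Equiv.sumArrowEquivProdArrow _ _ _).symm.sum_comp, Fintype.sum_prod_type]
  refine Finset.sum_congr rfl fun v _ => ?_
  rw [← (Equiv.curry _ _ _).symm.sum_comp]
  refine Finset.sum_congr rfl fun w _ => ?_
  set u : Fin (2 * n) → Fin (2 * n) := ((blockPairEquiv hm).arrowCongr (Equiv.refl (Fin (2 * n))))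
    ((Equiv.sumArrowEquivProdArrow _ _ _).symm (v, (Equiv.curry _ _ _).symm w)) with hu
  have hu1 (i : Fin (2 * m)) : u (blockPairEquiv hm (Sum.inl i)) = v i := by simp [hu]
  have hu2 (j : Fin (n - m)) (b : Fin 2) : u (blockPairEquiv hm (Sum.inr (j, b))) = w j b := by
    simp [hu, Function.uncurry]
  have hN : ((List.finRange (2 * n)).take (2 * m)).map u = List.ofFn v := by
    refine List.ext_getElem (by simp; omega) fun i h1 h2 => ?_
    have hi : i < 2 * m := by simpa using h2
    simp only [List.getElem_map, List.getElem_take, List.getElem_finRange, List.getElem_ofFn]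
    exact hu1 ⟨i, hi⟩
  have hD : (((List.finRange n).drop m).map fun j : Fin n =>
        D2 p q t (u ⟨2 * (j : ℕ), by omega⟩) (u ⟨2 * (j : ℕ) + 1, by omega⟩)) =
      List.ofFn fun j => D2 p q t (w j 0) (w j 1) := by
    refine List.ext_getElem (by simp) fun i h1 h2 => ?_
    have hi : i < n - m := by simpa using h2
    simp only [List.getElem_map, List.getElem_drop, List.getElem_finRange, List.getElem_ofFn]
    rw [← hu2 ⟨i, hi⟩ 0, ← hu2 ⟨i, hi⟩ 1]
    rfl
  rw [hN, hD, Nord_smul, ← (blockPairEquiv hm).prod_comp, Fintype.prod_sum_type,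
    Fintype.prod_prod_type]
  simp only [hu1, hu2, Fin.prod_univ_two, List.ofFn_eq_map]
  rw [list_prod_map_smul (fun j => x (w j 0) * x (w j 1)), smul_mul_smul_comm, Fin.prod_univ_def,
    Fin.prod_univ_def]

variable [Algebra ℚ R] [Algebra ℚ B] [IsScalarTower ℚ B R]

theorem prod_smul_wick {n : ℕ} {x : Fin (2 * n) → B} (hx : ∀ i, x i * x i = 0)
    {p q : Fin (2 * n) → R} {t : Fin (2 * n) → ℝ} (ht : Function.Injective t)
    (hpp : ∀ i j, p i * p j - p j * p i ∈ Subalgebra.center B R)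
    (hpq : ∀ i j, p i * q j - q j * p i ∈ Subalgebra.center B R)
    (hqq : ∀ i j, q i * q j - q j * q i ∈ Subalgebra.center B R) :
    (∏ i, x i) • Tlist p q t (List.finRange (2 * n)) =
      (∏ i, x i) • ∑ m ∈ Finset.range (n + 1),
        (((2 * m).factorial * (n - m).factorial * 2 ^ (n - m) : ℚ))⁻¹ •
          ∑ a : Equiv.Perm (Fin (2 * n)), NBlock p q a m * Dprod p q t a m := by
  unfold Tlist
  set l := (List.finRange (2 * n)).insertionSort (fun i j => t j ≤ t i) with hl
  have hperm : l.Perm (List.finRange (2 * n)) := List.perm_insertionSort _ _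
  have hsum (g : Fin (2 * n) → R) : (l.map g).sum = ∑ i, g i := by
    rw [(hperm.map g).sum_eq, Fin.sum_univ_def]
  have hprod : (l.map x).prod = ∏ i, x i := by
    rw [(hperm.map x).prod_eq, Fin.prod_univ_def]
  have hlen : l.length = 2 * n := by rw [hperm.length_eq, List.length_finRange]
  have hsorted : l.Pairwise fun i j => t j < t i := by
    have : IsTrans (Fin (2 * n)) (fun i j => t j ≤ t i) := ⟨fun _ _ _ h h' => h'.trans h⟩
    have : Std.Total (fun i j : Fin (2 * n) => t j ≤ t i) := ⟨fun _ _ => le_total _ _⟩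
    have h1 : l.Pairwise fun i j => t j ≤ t i := List.pairwise_insertionSort _ _
    have h2 : l.Pairwise fun i j => i ≠ j := hperm.nodup_iff.2 (List.nodup_finRange _)
    exact (h1.and h2).imp fun h => lt_of_le_of_ne h.1 fun h' => h.2 (ht h').symm
  have key := congrArg (PowerSeries.coeff (2 * n))
    (prod_one_add_eq_normalOrdered_series hx hpp hpq hqq l hsorted)
  have hT := (coeff_length_prod_one_add (l.map fun i => x i • psi p q i)).1
  rw [List.length_map, hlen, List.map_map, list_prod_map_smul, hprod] at hT
  rw [← hT]
  refine key.symm.trans ?_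
  rw [coeff_two_mul_normalOrdered_series, Finset.smul_sum]
  refine Finset.sum_congr rfl fun m hm => ?_
  rw [smul_comm (∏ i, x i), sum_perm_normalOrdered (Nat.lt_succ_iff.1 (Finset.mem_range.1 hm)) hx]
  simp only [contractionSum, hsum, Finset.smul_sum, smul_smul]

end FunctionSums

section SquareZero

theorem exists_squareZero_prod_ne_zero (N : ℕ) :
    ∃ (B : Type) (_ : CommRing B) (_ : Algebra ℚ B) (x : Fin N → B),
      (∀ i, x i * x i = 0) ∧ ∏ i, x i ≠ 0 := by
  let I : Ideal (MvPolynomial (Fin N) ℚ) := Ideal.span ((fun s => MvPolynomial.monomial s 1) ''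
    Set.range fun i : Fin N => Finsupp.single i 2)
  refine ⟨MvPolynomial (Fin N) ℚ ⧸ I, inferInstance, inferInstance,
    fun i => Ideal.Quotient.mk I (MvPolynomial.X i), fun i => ?_, ?_⟩
  · rw [← map_mul, Ideal.Quotient.eq_zero_iff_mem]
    refine Ideal.subset_span ⟨_, ⟨i, rfl⟩, ?_⟩
    rw [← pow_two, MvPolynomial.X_pow_eq_monomial]
  · rw [← map_prod, Ne, Ideal.Quotient.eq_zero_iff_mem, MvPolynomial.mem_ideal_span_monomial_image]
    intro h
    have hprod : (∏ i : Fin N, MvPolynomial.X i : MvPolynomial (Fin N) ℚ) =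
        MvPolynomial.monomial (∑ i, Finsupp.single i 1) 1 := by
      rw [MvPolynomial.monomial_sum_one]; rfl
    obtain ⟨_, ⟨i, rfl⟩, hi⟩ := h (∑ i, Finsupp.single i 1) (by simp [hprod])
    have := hi i
    simp [Finsupp.finsetSum_apply, Finsupp.single_apply] at this

theorem eq_zero_of_tmul_eq_zero {B A : Type*} [AddCommGroup B] [Module ℚ B] [AddCommGroup A]
    [Module ℚ A] {b : B} (hb : b ≠ 0) {a : A} (h : TensorProduct.tmul ℚ b a = 0) : a = 0 := by
  obtain ⟨f, hf⟩ : ∃ f : Module.Dual ℚ B, f b ≠ 0 := by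
    by_contra! h'
    exact hb ((Module.forall_dual_apply_eq_zero_iff ℚ b).1 h')
  have h1 := congrArg (fun z => TensorProduct.lid ℚ A (f.rTensor A z)) h
  simpa [hf] using h1

end SquareZero

section MapFields
variable {ι A R : Type*} [Ring A] [Ring R] (f : A →+* R) (p q : ι → A) (t : ι → ℝ)

theorem map_psi (i : ι) : f (psi p q i) = psi (f ∘ p) (f ∘ q) i := map_add f _ _

theorem map_D2 (i j : ι) : f (D2 p q t i j) = D2 (f ∘ p) (f ∘ q) t i j := by
  simp only [D2, T2, N2, map_sub, apply_ite f, map_mul, map_add, map_psi, Function.comp_apply]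

theorem map_Nord (L : List ι) : f (Nord p q L) = Nord (f ∘ p) (f ∘ q) L := by
  simp only [Nord, map_sum, map_mul, map_list_prod, List.map_map]
  rfl

theorem map_Tlist (L : List ι) : f (Tlist p q t L) = Tlist (f ∘ p) (f ∘ q) t L := by
  simp only [Tlist, map_list_prod, List.map_map, Function.comp_def, map_psi]

theorem map_NBlock {n : ℕ} (p q : Fin (2 * n) → A) (a : Equiv.Perm (Fin (2 * n))) (m : ℕ) :
    f (NBlock p q a m) = NBlock (f ∘ p) (f ∘ q) a m :=
  map_Nord f p q _

theorem map_Dprod {n : ℕ} (p q : Fin (2 * n) → A) (t : Fin (2 * n) → ℝ)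
    (a : Equiv.Perm (Fin (2 * n))) (m : ℕ) :
    f (Dprod p q t a m) = Dprod (f ∘ p) (f ∘ q) t a m := by
  simp only [Dprod, map_list_prod, List.map_map, Function.comp_def, map_D2]

end MapFields

theorem one_tmul_mem_center {B A : Type*} [CommRing B] [Algebra ℚ B] [Ring A] [Algebra ℚ A]
    {c : A} (hc : c ∈ Set.center A) :
    TensorProduct.tmul ℚ (1 : B) c ∈ Subalgebra.center B (TensorProduct ℚ B A) := by
  rw [Subalgebra.mem_center_iff]
  intro r
  induction r using TensorProduct.induction_on with
  | zero => simp
  | tmul b a =>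
    rw [Algebra.TensorProduct.tmul_mul_tmul, Algebra.TensorProduct.tmul_mul_tmul, one_mul, mul_one,
      Semigroup.mem_center_iff.1 hc a]
  | add u v hu hv => rw [add_mul, mul_add, hu, hv]

/-- **Paper's equation (p7): permutation-averaged Wick's theorem.**  Over a ℚ-algebra, if
all part-commutators are central and the times are pairwise distinct, then
`T(1,…,2n) = Σ_{m=0}^{n} (1/((2m)!·(n−m)!·2^{n−m})) •
               Σ_{a ∈ S_{2n}} N(a(1),…,a(2m))·∏_{j=m+1}^{n} D(a(2j−1),a(2j))`. -/
theorem stmt_12 {A : Type*} [Ring A] [Algebra ℚ A] (n : ℕ)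
    (psiP psiM : Fin (2 * n) → A) (t : Fin (2 * n) → ℝ) (ht : Function.Injective t)
    (hpp : ∀ i j : Fin (2 * n), psiP i * psiP j - psiP j * psiP i ∈ Set.center A)
    (hpm : ∀ i j : Fin (2 * n), psiP i * psiM j - psiM j * psiP i ∈ Set.center A)
    (hmp : ∀ i j : Fin (2 * n), psiM i * psiP j - psiP j * psiM i ∈ Set.center A)
    (hmm : ∀ i j : Fin (2 * n), psiM i * psiM j - psiM j * psiM i ∈ Set.center A) :
    Tlist psiP psiM t (List.finRange (2 * n)) =
      ∑ m ∈ Finset.range (n + 1),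
        (((2 * m).factorial * (n - m).factorial * 2 ^ (n - m) : ℚ))⁻¹ •
          ∑ a : Equiv.Perm (Fin (2 * n)),
            NBlock psiP psiM a m * Dprod psiP psiM t a m := by
  obtain ⟨B, _, _, x, hx, hne⟩ := exists_squareZero_prod_ne_zero (2 * n)
  let f : A →ₐ[ℚ] TensorProduct ℚ B A := Algebra.TensorProduct.includeRight
  have hcen {u v : A} (h : u * v - v * u ∈ Set.center A) :
      f u * f v - f v * f u ∈ Subalgebra.center B (TensorProduct ℚ B A) := by
    rw [← map_mul, ← map_mul, ← map_sub]
    exact one_tmul_mem_center h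
  have key := prod_smul_wick hx (p := f ∘ psiP) (q := f ∘ psiM) ht
    (fun i j => hcen (hpp i j)) (fun i j => hcen (hpm i j)) (fun i j => hcen (hmm i j))
  have hT := map_Tlist (f : A →+* TensorProduct ℚ B A) psiP psiM t (List.finRange (2 * n))
  have hN := map_NBlock (f : A →+* TensorProduct ℚ B A) psiP psiM
  have hD := map_Dprod (f : A →+* TensorProduct ℚ B A) psiP psiM t
  simp only [RingHom.coe_coe] at hT hN hD
  simp only [← hT, ← hN, ← hD, ← map_mul, ← map_sum, ← map_smul] at key
  rw [← sub_eq_zero, ← smul_sub, ← map_sub] at key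
  refine sub_eq_zero.1 (eq_zero_of_tmul_eq_zero hne ?_)
  simpa [f, TensorProduct.smul_tmul'] using key
end

section
/- Let a, b, c, d be field indices in a ring A with pairwise distinct times, and suppose every commutator [ψᵢ^ε, ψⱼ^δ] with ε, δ ∈ {+,−} lies in the center of A. Define S(a,b,c,d) := N(a,b,c,d) + D(a,b)N(c,d) + D(a,c)N(b,d) + D(a,d)N(b,c) + D(b,c)N(a,d) + D(b,d)N(a,c) + D(c,d)N(a,b) + D(a,b)D(c,d) + D(a,c)D(b,d) + D(a,d)D(b,c). Then S is invariant under interchanging its first two arguments: S(a,b,c,d) = S(b,a,c,d); more generally S(a,b,c,d) is invariant under all 4! permutations of its arguments. -/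
/-- The combination `S(a,b,c,d)` appearing in the 4-point Wick theorem (paper's eq. (p20)). -/
noncomputable def S4 {ι A : Type*} [Ring A] (psiP psiM : ι → A) (t : ι → ℝ)
    (a b c d : ι) : A :=
  Nord psiP psiM [a, b, c, d]
  + D2 psiP psiM t a b * Nord psiP psiM [c, d]
  + D2 psiP psiM t a c * Nord psiP psiM [b, d]
  + D2 psiP psiM t a d * Nord psiP psiM [b, c]
  + D2 psiP psiM t b c * Nord psiP psiM [a, d]
  + D2 psiP psiM t b d * Nord psiP psiM [a, c]
  + D2 psiP psiM t c d * Nord psiP psiM [a, b]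
  + D2 psiP psiM t a b * D2 psiP psiM t c d
  + D2 psiP psiM t a c * D2 psiP psiM t b d
  + D2 psiP psiM t a d * D2 psiP psiM t b c

section NormalOrder

variable {ι A : Type*} [Ring A] (P M : ι → A) (t : ι → ℝ)

lemma Nord_pair (a b : ι) :
    Nord P M [a, b] = P a * P b + M a * P b + M b * P a + M a * M b := by
  have huniv : (Finset.univ : Finset (Finset (Fin 2))) = {∅, {0}, {1}, {0, 1}} := by decide
  change ∑ S : Finset (Fin 2), _ = _
  rw [huniv]
  repeat rw [Finset.sum_insert (by decide)]
  simp [List.finRange_succ, List.filter_cons]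
  abel

lemma Nord_quadruple (a b c d : ι) :
    Nord P M [a, b, c, d] =
      P a * P b * P c * P d
      + M a * P b * P c * P d + M b * P a * P c * P d
      + M c * P a * P b * P d + M d * P a * P b * P c
      + M a * M b * P c * P d + M a * M c * P b * P d + M a * M d * P b * P c
      + M b * M c * P a * P d + M b * M d * P a * P c + M c * M d * P a * P b
      + M a * M b * M c * P d + M a * M b * M d * P c
      + M a * M c * M d * P b + M b * M c * M d * P a
      + M a * M b * M c * M d := by
  have huniv : (Finset.univ : Finset (Finset (Fin 4))) =
      {∅, {0}, {1}, {2}, {3}, {0, 1}, {0, 2}, {0, 3}, {1, 2}, {1, 3}, {2, 3},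
        {0, 1, 2}, {0, 1, 3}, {0, 2, 3}, {1, 2, 3}, {0, 1, 2, 3}} := by decide
  change ∑ S : Finset (Fin 4), _ = _
  rw [huniv]
  repeat rw [Finset.sum_insert (by decide)]
  simp [List.finRange_succ, List.filter_cons, mul_assoc]
  abel

/-- The commutators of the parts of the fields `i` and `j` are central. -/
def CentralComm (i j : ι) : Prop :=
  (P i * P j - P j * P i ∈ Set.center A) ∧ (P i * M j - M j * P i ∈ Set.center A) ∧
    (M i * P j - P j * M i ∈ Set.center A) ∧ (M i * M j - M j * M i ∈ Set.center A)

/-- The change of the normal ordered product under exchange of adjacent fields. -/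
def swapDefect (i j : ι) : A := (M i * M j - M j * M i) + (P i * P j - P j * P i)

variable {P M} in
lemma CentralComm.commute_swapDefect {i j : ι} (h : CentralComm P M i j) (x : A) :
    Commute (swapDefect P M i j) x :=
  ((Set.mem_center_iff.mp h.2.2.2).comm x).add_left ((Set.mem_center_iff.mp h.1).comm x)

variable {P M} in
lemma CentralComm.commute_D2 {i j : ι} (h : CentralComm P M i j) (x : A) :
    Commute (D2 P M t i j) x := by
  have hPP : Commute (P i * P j - P j * P i) x := (Set.mem_center_iff.mp h.1).comm x
  have hPM : Commute (P i * M j - M j * P i) x := (Set.mem_center_iff.mp h.2.1).comm x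
  have hMP : Commute (M i * P j - P j * M i) x := (Set.mem_center_iff.mp h.2.2.1).comm x
  have hMM : Commute (M i * M j - M j * M i) x := (Set.mem_center_iff.mp h.2.2.2).comm x
  unfold D2 T2 N2 psi
  split_ifs
  · convert hPM using 1
    noncomm_ring
  · convert ((hPP.add_left hMP).add_left hMM).neg_left using 1
    noncomm_ring

lemma D2_swap_s14 {i j : ι} (h : t i ≠ t j) :
    D2 P M t i j = D2 P M t j i - swapDefect P M i j := by
  unfold D2 T2 N2 psi swapDefect
  rcases h.lt_or_gt with h | h
  · simp only [gt_iff_lt, h, h.not_gt, if_true, if_false]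
    noncomm_ring
  · simp only [gt_iff_lt, h, h.not_gt, if_true, if_false]
    noncomm_ring

lemma Nord_pair_swap (i j : ι) :
    Nord P M [i, j] = Nord P M [j, i] + swapDefect P M i j := by
  rw [Nord_pair, Nord_pair, swapDefect]
  noncomm_ring

variable {P M}

lemma Nord_swap_first {a b : ι} (h : CentralComm P M a b) (c d : ι) :
    Nord P M [a, b, c, d] =
      Nord P M [b, a, c, d] + swapDefect P M a b * Nord P M [c, d] := by
  have hP (x : A) := (Set.mem_center_iff.mp h.1).comm x
  have h₁ := (hP (M c)).eq
  have h₂ := (hP (M d)).eq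
  have h₃ := (hP (M c * M d)).eq
  simp only [Nord_quadruple, Nord_pair, swapDefect]
  linear_combination (norm := noncomm_ring) -h₁ * P d - h₂ * P c - h₃

lemma Nord_swap_middle {b c : ι} (h : CentralComm P M b c) (a d : ι) :
    Nord P M [a, b, c, d] =
      Nord P M [a, c, b, d] + swapDefect P M b c * Nord P M [a, d] := by
  have hP (x : A) := (Set.mem_center_iff.mp h.1).comm x
  have hM (x : A) := (Set.mem_center_iff.mp h.2.2.2).comm x
  have h₁ := (hM (M a)).eq
  have h₂ := (hP (P a)).eq
  have h₃ := (hP (M a)).eq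
  have h₄ := (hP (M d * P a)).eq
  have h₅ := (hP (M a * M d)).eq
  simp only [Nord_quadruple, Nord_pair, swapDefect]
  linear_combination (norm := noncomm_ring)
    -h₁ * P d - h₁ * M d - h₂ * P d - h₃ * P d - h₄ - h₅

lemma Nord_swap_last {c d : ι} (h : CentralComm P M c d) (a b : ι) :
    Nord P M [a, b, c, d] =
      Nord P M [a, b, d, c] + swapDefect P M c d * Nord P M [a, b] := by
  have hP (x : A) := (Set.mem_center_iff.mp h.1).comm x
  have hM (x : A) := (Set.mem_center_iff.mp h.2.2.2).comm x
  have h₁ := (hM (M a)).eq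
  have h₂ := (hM (M b)).eq
  have h₃ := (hM (M a * M b)).eq
  have h₄ := (hP (P a * P b)).eq
  have h₅ := (hP (M a * P b)).eq
  have h₆ := (hP (M b * P a)).eq
  have h₇ := (hP (M a * M b)).eq
  simp only [Nord_quadruple, Nord_pair, swapDefect]
  linear_combination (norm := noncomm_ring)
    -h₁ * P b - h₂ * P a - h₃ - h₄ - h₅ - h₆ - h₇

variable {t}

lemma S4_swap_first {a b c d : ι} (ht : t a ≠ t b) (hab : CentralComm P M a b)
    (hac : CentralComm P M a c) (had : CentralComm P M a d) :
    S4 P M t a b c d = S4 P M t b a c d := by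
  have h₁ := (hab.commute_swapDefect (D2 P M t c d)).eq
  have h₂ := (hac.commute_D2 t (D2 P M t b d)).eq
  have h₃ := (had.commute_D2 t (D2 P M t b c)).eq
  simp only [S4]
  rw [Nord_swap_first hab, D2_swap_s14 P M t ht, Nord_pair_swap P M a b]
  linear_combination (norm := noncomm_ring) -h₁ + h₂ + h₃

lemma S4_swap_middle {a b c d : ι} (ht : t b ≠ t c) (hbc : CentralComm P M b c) :
    S4 P M t a b c d = S4 P M t a c b d := by
  simp only [S4]
  rw [Nord_swap_middle hbc, D2_swap_s14 P M t ht, Nord_pair_swap P M b c]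
  noncomm_ring

lemma S4_swap_last {a b c d : ι} (ht : t c ≠ t d) (hcd : CentralComm P M c d) :
    S4 P M t a b c d = S4 P M t a b d c := by
  simp only [S4]
  rw [Nord_swap_last hcd, D2_swap_s14 P M t ht, Nord_pair_swap P M c d]
  noncomm_ring

lemma S4_perm (p : Fin 4 → ι) (ht : Function.Injective (t ∘ p))
    (hc : ∀ i j, CentralComm P M (p i) (p j)) (σ : Equiv.Perm (Fin 4)) :
    S4 P M t (p (σ 0)) (p (σ 1)) (p (σ 2)) (p (σ 3)) =
      S4 P M t (p 0) (p 1) (p 2) (p 3) := by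
  have hσ : σ ∈ Submonoid.closure
      (Set.range fun i : Fin 3 ↦ Equiv.swap i.castSucc i.succ) := by
    rw [Equiv.Perm.mclosure_swap_castSucc_succ]
    trivial
  induction hσ using Submonoid.closure_induction_right with
  | one => rfl
  | mul_right τ hτ s hs ih =>
    rw [← ih]
    have hne {i j : Fin 4} (hij : i ≠ j) : t (p (τ i)) ≠ t (p (τ j)) :=
      fun h ↦ hij (τ.injective (ht h))
    obtain ⟨i, rfl⟩ := hs
    fin_cases i
    · exact S4_swap_first (hne (by decide)) (hc _ _) (hc _ _) (hc _ _)
    · exact S4_swap_middle (hne (by decide)) (hc _ _)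
    · exact S4_swap_last (hne (by decide)) (hc _ _)

end NormalOrder

/-- If the part-commutators of the four fields are central and the times are pairwise
distinct, then `S(a,b,c,d) = S(b,a,c,d)`, and more generally `S` is invariant under all
`4!` permutations of its arguments. -/
theorem stmt_14 {ι A : Type*} [Ring A] (psiP psiM : ι → A) (t : ι → ℝ)
    (a b c d : ι)
    (ht : List.Pairwise (fun i j => t i ≠ t j) [a, b, c, d])
    (hc : ∀ i ∈ ({a, b, c, d} : Set ι), ∀ j ∈ ({a, b, c, d} : Set ι),
      (psiP i * psiP j - psiP j * psiP i ∈ Set.center A) ∧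
      (psiP i * psiM j - psiM j * psiP i ∈ Set.center A) ∧
      (psiM i * psiP j - psiP j * psiM i ∈ Set.center A) ∧
      (psiM i * psiM j - psiM j * psiM i ∈ Set.center A)) :
    S4 psiP psiM t a b c d = S4 psiP psiM t b a c d ∧
    ∀ σ : Equiv.Perm (Fin 4),
      S4 psiP psiM t (![a, b, c, d] (σ 0)) (![a, b, c, d] (σ 1))
          (![a, b, c, d] (σ 2)) (![a, b, c, d] (σ 3)) =
        S4 psiP psiM t a b c d := by
  have hp (k : Fin 4) : ![a, b, c, d] k ∈ ({a, b, c, d} : Set ι) := by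
    fin_cases k <;> simp
  have hc' (i j : Fin 4) : CentralComm psiP psiM (![a, b, c, d] i) (![a, b, c, d] j) :=
    hc _ (hp i) _ (hp j)
  have ht' : Function.Injective (t ∘ ![a, b, c, d]) := by
    simp only [List.pairwise_cons, List.mem_cons, List.not_mem_nil, or_false, forall_eq_or_imp,
      forall_eq] at ht
    intro i j hij
    fin_cases i <;> fin_cases j <;> simp_all
  exact ⟨S4_swap_first (ht'.ne (a₁ := 0) (a₂ := 1) (by decide)) (hc' 0 1) (hc' 0 2) (hc' 0 3),
    S4_perm _ ht' hc'⟩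
end
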